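/- arXiv:1011.6410 — 4 statements merged into one kernel-verified Lean document; each statement's English description precedes it below -/
import Mathlib

section
/- Let m be a nonnegative integer and let (c_j)_{j≥1} be complex numbers. Set u = −m(m+1)z⁻² + Σ_{j≥1} c_j z^j ∈ ℂ((z)). Then the following are equivalent: (a) for every λ ∈ ℂ, the set of ψ ∈ ℂ((z)) satisfying ψ'' + uψ = λψ contains two linearly independent elements; (b) c₁ = c₃ = ⋯ = c_{2m−1} = 0, i.e., c_j = 0 for every odd j with 1 ≤ j ≤ 2m−1. -/
open HahnSeries

/-- The formal derivative of a formal Laurent series `Σₙ aₙ zⁿ ↦ Σₙ n aₙ z^{n−1}`. -/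
noncomputable def laurentDeriv (f : LaurentSeries ℂ) : LaurentSeries ℂ where
  coeff n := ((n + 1 : ℤ) : ℂ) * f.coeff (n + 1)
  isPWO_support' := by
    refine Set.IsPWO.mono (Set.IsPWO.image_of_monotone f.isPWO_support
      (f := fun m : ℤ => m - 1) (fun a b hab => by simpa using hab)) ?_
    intro n hn
    have h1 : f.coeff (n + 1) ≠ 0 := by
      intro h0
      simp only [Function.mem_support, h0, mul_zero, ne_eq, not_true_eq_false] at hn
    exact ⟨n + 1, h1, by ring⟩

lemma laurentDeriv_coeff (f : LaurentSeries ℂ) (n : ℤ) :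
    (laurentDeriv f).coeff n = ((n + 1 : ℤ) : ℂ) * f.coeff (n + 1) := rfl

/-- The coefficient of `z^(k-2)` in the product of the power series with coefficients `e`
and `a`, which is zero for `k < 2`. -/
def shiftedConv {R : Type*} [CommRing R] (e a : ℕ → R) (k : ℕ) : R :=
  ∑ i ∈ Finset.range (k - 1), e (k - 2 - i) * a i

lemma shiftedConv_congr {R : Type*} [CommRing R] (e : ℕ → R) {a b : ℕ → R} {k : ℕ}
    (h : ∀ i < k, a i = b i) :
    shiftedConv e a k = shiftedConv e b k := by
  refine Finset.sum_congr rfl fun i hi => ?_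
  rw [h i (by have := Finset.mem_range.1 hi; omega)]

/-- The Laurent series `zⁿ Σ_{k ≥ 0} a_k z^k`. -/
noncomputable def shiftedSeries (n : ℤ) (a : ℕ → ℂ) : LaurentSeries ℂ :=
  single n 1 * ofPowerSeries ℤ ℂ (PowerSeries.mk a)

lemma shiftedSeries_coeff (n t : ℤ) (a : ℕ → ℂ) :
    (shiftedSeries n a).coeff t = if t < n then 0 else a (t - n).toNat := by
  unfold shiftedSeries
  rw [coeff_single_mul, one_mul, PowerSeries.coeff_coe]
  split_ifs with h1 h2 h2
  · rfl
  · omega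
  · omega
  · rw [PowerSeries.coeff_mk]; congr 1; omega

lemma shiftedSeries_coeff_add (n : ℤ) (a : ℕ → ℂ) (k : ℕ) :
    (shiftedSeries n a).coeff (n + k) = a k := by
  simp [shiftedSeries_coeff]

lemma eq_shiftedSeries_order (ψ : LaurentSeries ℂ) :
    ψ = shiftedSeries ψ.order fun k => ψ.coeff (ψ.order + k) := by
  ext t
  rw [shiftedSeries_coeff]
  split_ifs with h
  · exact coeff_eq_zero_of_lt_order h
  · congr 1; omega

lemma coeff_ofPowerSeries_mul_shiftedSeries (n : ℤ) (e a : ℕ → ℂ) (k : ℕ) :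
    (ofPowerSeries ℤ ℂ (PowerSeries.mk e) * shiftedSeries n a).coeff (n + k - 2)
      = shiftedConv e a k := by
  unfold shiftedSeries
  rw [mul_left_comm, ← map_mul, coeff_single_mul, one_mul, PowerSeries.coeff_coe]
  unfold shiftedConv
  obtain hk | ⟨l, rfl⟩ : k < 2 ∨ ∃ l, k = l + 2 := by
    by_cases h : k < 2
    · exact Or.inl h
    · exact Or.inr ⟨k - 2, by omega⟩
  · rw [if_pos (by omega)]
    have : k - 1 = 0 := by omega
    simp [this]
  · rw [if_neg (by omega), show (n + ((l + 2 : ℕ) : ℤ) - 2 - n).natAbs = l by omega,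
      mul_comm, PowerSeries.coeff_mul, Finset.Nat.sum_antidiagonal_eq_sum_range_succ_mk]
    simp [mul_comm]

lemma coeff_ofPowerSeries_mul_shiftedSeries_of_lt (n t : ℤ) (e a : ℕ → ℂ) (ht : t < n) :
    (ofPowerSeries ℤ ℂ (PowerSeries.mk e) * shiftedSeries n a).coeff t = 0 := by
  unfold shiftedSeries
  rw [mul_left_comm, ← map_mul, coeff_single_mul, one_mul, PowerSeries.coeff_coe,
    if_pos (by omega)]

/-- The differential equation `ψ'' + (b z⁻² + Σ e_j z^j) ψ = 0` on the level of coefficients. -/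
lemma ode_shiftedSeries_iff (b : ℂ) (e a : ℕ → ℂ) (n : ℤ) :
    laurentDeriv (laurentDeriv (shiftedSeries n a)) +
        (single (-2 : ℤ) b + ofPowerSeries ℤ ℂ (PowerSeries.mk e)) * shiftedSeries n a = 0 ↔
      ∀ k : ℕ, (((n : ℂ) + k) * (n + k - 1) + b) * a k + shiftedConv e a k = 0 := by
  have key (t : ℤ) : (laurentDeriv (laurentDeriv (shiftedSeries n a)) +
        (single (-2 : ℤ) b + ofPowerSeries ℤ ℂ (PowerSeries.mk e)) * shiftedSeries n a).coeff (t - 2)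
      = ((t : ℂ) * (t - 1) + b) * (shiftedSeries n a).coeff t
        + (ofPowerSeries ℤ ℂ (PowerSeries.mk e) * shiftedSeries n a).coeff (t - 2) := by
    rw [add_mul, coeff_add, coeff_add, laurentDeriv_coeff, laurentDeriv_coeff, coeff_single_mul,
      show t - 2 + 1 + 1 = t by ring, show t - 2 - -2 = t by ring]
    push_cast
    ring
  constructor
  · intro h k
    have := key (n + k)
    rw [h, shiftedSeries_coeff_add, coeff_ofPowerSeries_mul_shiftedSeries] at this
    push_cast at this
    rw [← this]
    rfl
  · intro h
    ext t
    obtain ⟨t, rfl⟩ : ∃ s, t = s - 2 := ⟨t + 2, by ring⟩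
    rw [key]
    rcases lt_or_ge t n with ht | ht
    · rw [shiftedSeries_coeff, if_pos ht,
        coeff_ofPowerSeries_mul_shiftedSeries_of_lt _ _ _ _ (by omega)]
      simp
    · obtain ⟨k, rfl⟩ : ∃ k : ℕ, t = n + k := ⟨(t - n).toNat, by omega⟩
      rw [shiftedSeries_coeff_add, coeff_ofPowerSeries_mul_shiftedSeries]
      push_cast
      rw [h k]
      rfl

/-- The solution of `a 0 = 1`, `q k * a k = shiftedConv e a k`, with `a k = 0` whenever `k ≠ 0`
and `q k = 0`. -/
noncomputable def frobeniusSeq {R : Type*} [CommRing R] [Algebra ℂ R] (q : ℕ → ℂ) (e : ℕ → R) :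
    ℕ → R
  | 0 => 1
  | k + 1 => (q (k + 1))⁻¹ • ∑ i : Fin k, e (k - 1 - i) * frobeniusSeq q e i

section
variable {R : Type*} [CommRing R] [Algebra ℂ R] (q : ℕ → ℂ) (e : ℕ → R)

lemma frobeniusSeq_zero : frobeniusSeq q e 0 = 1 := by
  rw [frobeniusSeq]

lemma frobeniusSeq_of_ne_zero {k : ℕ} (hk : k ≠ 0) :
    frobeniusSeq q e k = (q k)⁻¹ • shiftedConv e (frobeniusSeq q e) k := by
  obtain ⟨k, rfl⟩ := Nat.exists_eq_succ_of_ne_zero hk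
  rw [Nat.succ_eq_add_one, frobeniusSeq, shiftedConv, Nat.add_sub_cancel,
    Fin.sum_univ_eq_sum_range (fun i => e (k - 1 - i) * frobeniusSeq q e i)]
  rfl

/-- A sequence obeying the recursion below an index is given there by the Frobenius recursion. -/
lemma eq_frobeniusSeq {a : ℕ → R} {N : ℕ} (h0 : a 0 = 1) (hq : ∀ k < N, k ≠ 0 → q k ≠ 0)
    (h : ∀ k < N, q k • a k = shiftedConv e a k) :
    ∀ k < N, a k = frobeniusSeq q e k := by
  intro k
  induction k using Nat.strong_induction_on with
  | _ k ih =>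
    intro hk
    rcases eq_or_ne k 0 with rfl | h1
    · rw [h0, frobeniusSeq_zero]
    · rw [frobeniusSeq_of_ne_zero q e h1,
        ← shiftedConv_congr e fun i hi => ih i hi (hi.trans hk), ← h k hk,
        inv_smul_smul₀ (hq k hk h1)]

end

lemma map_frobeniusSeq {R S : Type*} [CommRing R] [Algebra ℂ R] [CommRing S] [Algebra ℂ S]
    (φ : R →ₐ[ℂ] S) (q : ℕ → ℂ) (e : ℕ → R) (k : ℕ) :
    φ (frobeniusSeq q e k) = frobeniusSeq q (fun j => φ (e j)) k := by
  induction k using Nat.strong_induction_on with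
  | _ k ih =>
    rcases eq_or_ne k 0 with rfl | h1
    · simp [frobeniusSeq_zero]
    · rw [frobeniusSeq_of_ne_zero _ _ h1, frobeniusSeq_of_ne_zero _ _ h1, map_smul, shiftedConv,
        map_sum]
      congr 1
      refine Finset.sum_congr rfl fun i hi => ?_
      rw [map_mul, ih i (by have := Finset.mem_range.1 hi; omega)]

open Polynomial in
/-- The coefficients of `p` at and above degree `(k - t) / 2` are nonnegative multiples of `γ`,
zero above that degree and a positive multiple of `γ` in that degree. -/
def HasPosTopCoeff (γ : ℂ) (t k : ℕ) (p : ℂ[X]) : Prop :=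
  ∀ n, k ≤ 2 * n + t → ∃ x : ℝ, 0 ≤ x ∧ p.coeff n = γ * x ∧
    (k < 2 * n + t → x = 0) ∧ (k = 2 * n + t → 0 < x)

lemma HasPosTopCoeff.smul {γ : ℂ} {t k : ℕ} {p : Polynomial ℂ} (h : HasPosTopCoeff γ t k p)
    {d : ℝ} (hd : 0 < d) : HasPosTopCoeff γ t k ((d : ℂ) • p) := by
  intro n hn
  obtain ⟨x, hx, hz, h1, h2⟩ := h n hn
  refine ⟨d * x, by positivity, ?_, fun h => by simp [h1 h], fun h => mul_pos hd (h2 h)⟩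
  rw [Polynomial.coeff_smul, hz, smul_eq_mul]
  push_cast
  ring

lemma exists_sum_eq_mul {ι : Type*} (s : Finset ι) (f : ι → ℂ) (γ : ℂ) (A B : Prop)
    (h : ∀ i ∈ s, ∃ x : ℝ, 0 ≤ x ∧ f i = γ * x ∧ (A → x = 0))
    (hB : B → ∃ i ∈ s, ∀ x : ℝ, 0 ≤ x → f i = γ * x → 0 < x) :
    ∃ x : ℝ, 0 ≤ x ∧ ∑ i ∈ s, f i = γ * x ∧ (A → x = 0) ∧ (B → 0 < x) := by
  choose! x hx hf hA using h
  refine ⟨∑ i ∈ s, x i, Finset.sum_nonneg hx, ?_,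
    fun ha => Finset.sum_eq_zero fun i hi => hA i hi ha, fun hb => ?_⟩
  · push_cast
    rw [Finset.mul_sum]
    exact Finset.sum_congr rfl hf
  · obtain ⟨i, hi, h⟩ := hB hb
    exact Finset.sum_pos' hx ⟨i, hi, h _ (hx i hi) (hf i hi)⟩

section
open Polynomial
variable {c : ℕ → ℂ} {e a : ℕ → ℂ[X]} {s k : ℕ}

lemma hasPosTopCoeff_shiftedConv_even
    (he0 : e 0 = X) (he : ∀ j ≠ 0, e j = C (c j))
    (h_even : ∀ i < k, Even i → HasPosTopCoeff 1 0 i (a i))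
    (h_odd : ∀ i < k, Odd i → HasPosTopCoeff (c s) (s + 2) i (a i))
    (hk : Even k) (hk0 : k ≠ 0) : HasPosTopCoeff 1 0 k (shiftedConv e a k) := by
  intro n hn
  have hk2 : 2 ≤ k := by obtain ⟨l, rfl⟩ := hk; omega
  obtain ⟨n, rfl⟩ : ∃ l, n = l + 1 := ⟨n - 1, by omega⟩
  obtain ⟨y, hy, hyz, hy1, hy2⟩ := h_even (k - 2) (by omega) (by grind) n (by omega)
  have hlast : (e (k - 2 - (k - 2)) * a (k - 2)).coeff (n + 1) = 1 * (y : ℂ) := by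
    rw [Nat.sub_self, he0, coeff_X_mul, hyz]
  rw [shiftedConv, finsetSum_coeff]
  refine exists_sum_eq_mul _ _ _ _ _ (fun i hi => ?_)
    fun hB => ⟨k - 2, Finset.mem_range.2 (by omega), fun x _ hx => ?_⟩
  · have hi' : i ≤ k - 2 := by have := Finset.mem_range.1 hi; omega
    rcases hi'.eq_or_lt with rfl | hlt
    · exact ⟨y, hy, hlast, fun h => hy1 (by omega)⟩
    · refine ⟨0, le_rfl, ?_, fun _ => rfl⟩
      rw [he _ (by omega), coeff_C_mul]
      rcases Nat.even_or_odd i with hie | hio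
      · obtain ⟨x, -, hx, hx0, -⟩ := h_even i (by omega) hie (n + 1) (by omega)
        simp [hx, hx0 (by omega)]
      · obtain ⟨x, -, hx, hx0, -⟩ := h_odd i (by omega) hio (n + 1) (by omega)
        simp [hx, hx0 (by omega)]
  · rw [hlast, one_mul, one_mul, Complex.ofReal_inj] at hx
    exact hx ▸ hy2 (by omega)

lemma hasPosTopCoeff_shiftedConv_odd
    (he0 : e 0 = X) (he : ∀ j ≠ 0, e j = C (c j)) (hs : Odd s) (hc : ∀ j < s, Odd j → c j = 0)
    (hcs : c s ≠ 0)
    (h_even : ∀ i < k, Even i → HasPosTopCoeff 1 0 i (a i))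
    (h_odd : ∀ i < k, Odd i → HasPosTopCoeff (c s) (s + 2) i (a i))
    (hk : Odd k) : HasPosTopCoeff (c s) (s + 2) k (shiftedConv e a k) := by
  intro n hn
  have hs0 : s ≠ 0 := by rintro rfl; simp at hs
  rw [shiftedConv, finsetSum_coeff]
  refine exists_sum_eq_mul _ _ _ _ _ (fun i hi => ?_)
    fun hB => ⟨k - 2 - s, Finset.mem_range.2 (by omega), fun x _ hx => ?_⟩
  · have hi' : i ≤ k - 2 := by have := Finset.mem_range.1 hi; omega
    have hik : i < k - 1 := Finset.mem_range.1 hi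
    rcases hi'.eq_or_lt with rfl | hlt
    · rw [Nat.sub_self, he0]
      rcases n with _ | n
      · exact ⟨0, le_rfl, by simp, fun _ => rfl⟩
      · obtain ⟨y, hy, hyz, hy1, -⟩ := h_odd (k - 2) (by omega) (by grind) n (by omega)
        exact ⟨y, hy, by rw [coeff_X_mul, hyz], fun h => hy1 (by omega)⟩
    · rw [he _ (by omega), coeff_C_mul]
      rcases Nat.even_or_odd i with hie | hio
      · have hj : Odd (k - 2 - i) := by grind
        rcases lt_trichotomy (k - 2 - i) s with h | h | h
        · exact ⟨0, le_rfl, by simp [hc _ h hj], fun _ => rfl⟩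
        · obtain ⟨x, hx, hxz, hx0, -⟩ := h_even i (by omega) hie n (by omega)
          exact ⟨x, hx, by rw [hxz, h, one_mul], fun _ => hx0 (by omega)⟩
        · obtain ⟨x, -, hxz, hx0, -⟩ := h_even i (by omega) hie n (by omega)
          exact ⟨0, le_rfl, by simp [hxz, hx0 (by omega)], fun _ => rfl⟩
      · obtain ⟨x, -, hxz, hx0, -⟩ := h_odd i (by omega) hio n (by omega)
        exact ⟨0, le_rfl, by simp [hxz, hx0 (by omega)], fun _ => rfl⟩
  · obtain ⟨y, -, hyz, -, hy⟩ := h_even (k - 2 - s) (by omega) (by grind) n (by omega)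
    rw [show k - 2 - (k - 2 - s) = s by omega, he s hs0, coeff_C_mul, hyz, one_mul] at hx
    rw [← Complex.ofReal_inj.1 (mul_left_cancel₀ hcs hx)]
    exact hy (by omega)

/-- If `c s` is the first nonzero coefficient of odd index, the Frobenius coefficients, as
polynomials in the spectral parameter, have positive leading coefficients in even degree, and
positive multiples of `c s` as leading coefficients in odd degree. -/
lemma hasPosTopCoeff_frobeniusSeq {d : ℕ → ℝ} {N : ℕ} (hd : ∀ k < N, k ≠ 0 → 0 < d k)
    (he0 : e 0 = X) (he : ∀ j ≠ 0, e j = C (c j)) (hs : Odd s) (hc : ∀ j < s, Odd j → c j = 0)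
    (hcs : c s ≠ 0) (k : ℕ) (hk : k < N) :
    (Even k → HasPosTopCoeff 1 0 k (frobeniusSeq (fun k => (d k : ℂ)) e k)) ∧
      (Odd k → HasPosTopCoeff (c s) (s + 2) k (frobeniusSeq (fun k => (d k : ℂ)) e k)) := by
  induction k using Nat.strong_induction_on with
  | _ k ih =>
    have h_even i (hi : i < k) := (ih i hi (hi.trans hk)).1
    have h_odd i (hi : i < k) := (ih i hi (hi.trans hk)).2
    rcases eq_or_ne k 0 with rfl | hk0
    · refine ⟨fun _ n _ => ?_, fun h => by simp at h⟩
      rw [frobeniusSeq_zero, Polynomial.coeff_one]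
      rcases n with _ | n
      · exact ⟨1, by simp⟩
      · exact ⟨0, by simp⟩
    · rw [frobeniusSeq_of_ne_zero _ _ hk0, ← Complex.ofReal_inv]
      have hdk := inv_pos.2 (hd k hk hk0)
      exact ⟨fun h => (hasPosTopCoeff_shiftedConv_even he0 he h_even h_odd h hk0).smul hdk,
        fun h => (hasPosTopCoeff_shiftedConv_odd he0 he hs hc hcs h_even h_odd h).smul hdk⟩

/-- If the compatibility condition at the odd index `k` holds for every spectral parameter, all
coefficients of odd index at most `k - 2` vanish. -/
lemma odd_coeffs_eq_zero {d : ℕ → ℝ} (hd : ∀ i < k, i ≠ 0 → 0 < d i) (hk : Odd k)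
    (h : ∀ μ : ℂ, shiftedConv (fun j => if j = 0 then μ else c j)
      (frobeniusSeq (fun i => (d i : ℂ)) (fun j => if j = 0 then μ else c j)) k = 0)
    (hs : Odd s) (hsk : s + 2 ≤ k) : c s = 0 := by
  induction s using Nat.strong_induction_on with
  | _ s ih =>
    by_contra hcs
    have hc : ∀ j < s, Odd j → c j = 0 := fun j hj ho => ih j hj ho (by omega)
    set e : ℕ → ℂ[X] := fun j => if j = 0 then X else C (c j) with he
    have he0 : e 0 = X := by simp [he]
    have hej : ∀ j ≠ 0, e j = C (c j) := fun j hj => by simp [he, hj]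
    have hP := hasPosTopCoeff_frobeniusSeq hd he0 hej hs hc hcs
    have hzero : shiftedConv e (frobeniusSeq (fun i => (d i : ℂ)) e) k = 0 := by
      refine Polynomial.funext fun μ => ?_
      have hev : (fun j => aeval μ (e j)) = fun j => if j = 0 then μ else c j := by
        funext j
        by_cases hj : j = 0 <;> simp [he, hj]
      rw [eval_zero, ← h μ, ← hev, ← coe_aeval_eq_eval, shiftedConv, shiftedConv, map_sum]
      refine Finset.sum_congr rfl fun i _ => ?_
      rw [map_mul, map_frobeniusSeq]
    obtain ⟨x, -, hx, -, hpos⟩ := hasPosTopCoeff_shiftedConv_odd he0 hej hs hc hcs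
      (fun i hi => (hP i hi).1) (fun i hi => (hP i hi).2) hk ((k - (s + 2)) / 2) (by grind)
    rw [hzero, Polynomial.coeff_zero, eq_comm, mul_eq_zero] at hx
    have := hpos (by grind)
    rcases hx with hx | hx
    · exact hcs hx
    · exact this.ne' (Complex.ofReal_eq_zero.1 hx)

end

lemma shiftedConv_odd_eq_zero {e a : ℕ → ℂ} {k : ℕ} (hk : Odd k)
    (he : ∀ j, j + 2 ≤ k → Odd j → e j = 0) (ha : ∀ i < k, Odd i → a i = 0) :
    shiftedConv e a k = 0 := by
  refine Finset.sum_eq_zero fun i hi => ?_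
  have hi := Finset.mem_range.1 hi
  rcases Nat.even_or_odd i with h | h
  · rw [he _ (by omega) (by grind), zero_mul]
  · rw [ha i (by omega) h, mul_zero]

lemma frobeniusSeq_odd_eq_zero {q e : ℕ → ℂ} {N : ℕ} (he : ∀ j, j + 2 ≤ N → Odd j → e j = 0)
    (k : ℕ) (hkN : k ≤ N) (hk : Odd k) : frobeniusSeq q e k = 0 := by
  induction k using Nat.strong_induction_on with
  | _ k ih =>
    rw [frobeniusSeq_of_ne_zero _ _ (by rintro rfl; simp at hk),
      shiftedConv_odd_eq_zero hk (fun j hj => he j (by omega))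
        fun i hi => ih i hi (by omega), smul_zero]

/-- The indicial equation: a nonzero solution starts in degree `-m` or `m + 1`. -/
lemma order_eq_of_ode {m : ℕ} {e : ℕ → ℂ} {ψ : LaurentSeries ℂ} (hψ : ψ ≠ 0)
    (h : laurentDeriv (laurentDeriv ψ) + (single (-2 : ℤ) (-((m : ℂ) * (m + 1)))
      + ofPowerSeries ℤ ℂ (PowerSeries.mk e)) * ψ = 0) :
    ψ.order = -m ∨ ψ.order = m + 1 := by
  rw [eq_shiftedSeries_order ψ, ode_shiftedSeries_iff] at h
  have h0 := h 0
  simp only [shiftedConv, Nat.zero_sub, Finset.range_zero, Finset.sum_empty, add_zero,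
    Nat.cast_zero] at h0
  have h1 := (mul_eq_zero.1 h0).resolve_right (coeff_order_eq_zero.not.2 hψ)
  have h2 : ψ.order * (ψ.order - 1) + -((m : ℤ) * (m + 1)) = 0 := by exact_mod_cast h1
  have h3 : (ψ.order + m) * (ψ.order - (m + 1)) = 0 := by linear_combination h2
  rcases mul_eq_zero.1 h3 with h | h
  · left; omega
  · right; omega

/-- The compatibility condition implied by a solution that starts in degree `-m`. -/
lemma shiftedConv_eq_zero_of_order_eq {m : ℕ} {e : ℕ → ℂ} {ψ : LaurentSeries ℂ} (hψ : ψ ≠ 0)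
    (h : laurentDeriv (laurentDeriv ψ) + (single (-2 : ℤ) (-((m : ℂ) * (m + 1)))
      + ofPowerSeries ℤ ℂ (PowerSeries.mk e)) * ψ = 0) (ho : ψ.order = -m) :
    shiftedConv e (frobeniusSeq (fun k => ((k * (2 * m + 1 - k) : ℝ) : ℂ)) e) (2 * m + 1) = 0 := by
  rw [eq_shiftedSeries_order ψ, ode_shiftedSeries_iff, ho] at h
  set x := ψ.coeff (-m) with hx
  have hx0 : x ≠ 0 := by rw [hx, ← ho]; exact coeff_order_eq_zero.not.2 hψ
  set a : ℕ → ℂ := fun k => x⁻¹ * ψ.coeff (-m + k) with ha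
  have hS (k : ℕ) : shiftedConv e a k = x⁻¹ * shiftedConv e (fun k => ψ.coeff (-m + k)) k := by
    rw [shiftedConv, shiftedConv, Finset.mul_sum]
    exact Finset.sum_congr rfl fun i _ => by rw [ha]; ring
  have hrec (k : ℕ) : ((k * (2 * m + 1 - k) : ℝ) : ℂ) * a k = shiftedConv e a k := by
    have := h k
    rw [hS]
    simp only [ha]
    push_cast at this ⊢
    linear_combination (-x⁻¹) * this
  rw [← shiftedConv_congr e (eq_frobeniusSeq (fun k => ((k * (2 * m + 1 - k) : ℝ) : ℂ)) e (a := a)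
    (by simp [ha, ← hx, hx0]) (fun k hk hk0 => ?_) fun k _ => hrec k), ← hrec]
  · simp
  · have : (k : ℝ) < 2 * m + 1 := by exact_mod_cast hk
    exact Complex.ofReal_ne_zero.2 (mul_ne_zero (Nat.cast_ne_zero.2 hk0) (by linarith))

/-- Two solutions that both start in degree `m + 1` are linearly dependent. -/
lemma exists_order_eq_neg {m : ℕ} {e : ℕ → ℂ} {ψ₁ ψ₂ : LaurentSeries ℂ}
    (h₁ : laurentDeriv (laurentDeriv ψ₁) + (single (-2 : ℤ) (-((m : ℂ) * (m + 1)))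
      + ofPowerSeries ℤ ℂ (PowerSeries.mk e)) * ψ₁ = 0)
    (h₂ : laurentDeriv (laurentDeriv ψ₂) + (single (-2 : ℤ) (-((m : ℂ) * (m + 1)))
      + ofPowerSeries ℤ ℂ (PowerSeries.mk e)) * ψ₂ = 0)
    (hli : LinearIndependent ℂ ![ψ₁, ψ₂]) : ψ₁.order = -m ∨ ψ₂.order = -m := by
  have hne₁ : ψ₁ ≠ 0 := hli.ne_zero 0
  have hne₂ : ψ₂ ≠ 0 := hli.ne_zero 1
  by_contra! hcon
  have ho₁ := (order_eq_of_ode hne₁ h₁).resolve_left hcon.1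
  have ho₂ := (order_eq_of_ode hne₂ h₂).resolve_left hcon.2
  have hc₁ : ψ₁.coeff (m + 1) ≠ 0 := by rw [← ho₁]; exact coeff_order_eq_zero.not.2 hne₁
  have hc₂ : ψ₂.coeff (m + 1) ≠ 0 := by rw [← ho₂]; exact coeff_order_eq_zero.not.2 hne₂
  have hdep : ψ₂.coeff (m + 1) • ψ₁ + (-ψ₁.coeff (m + 1)) • ψ₂ = 0 := by
    set φ := ψ₂.coeff (m + 1) • ψ₁ + (-ψ₁.coeff (m + 1)) • ψ₂ with hφ
    have hcoeff (n : ℤ) : φ.coeff n =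
        ψ₂.coeff (m + 1) * ψ₁.coeff n + (-ψ₁.coeff (m + 1)) * ψ₂.coeff n := rfl
    by_contra hne
    have hode : laurentDeriv (laurentDeriv φ) + (single (-2 : ℤ) (-((m : ℂ) * (m + 1)))
        + ofPowerSeries ℤ ℂ (PowerSeries.mk e)) * φ = 0 := by
      have hD : laurentDeriv (laurentDeriv φ) =
          ψ₂.coeff (m + 1) • laurentDeriv (laurentDeriv ψ₁) +
            (-ψ₁.coeff (m + 1)) • laurentDeriv (laurentDeriv ψ₂) := by
        ext n
        simp only [coeff_add, coeff_smul, laurentDeriv_coeff, hcoeff, smul_eq_mul]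
        ring
      rw [hD, hφ]
      simp only [← C_mul_eq_smul]
      linear_combination C (ψ₂.coeff (m + 1)) * h₁ + C (-ψ₁.coeff (m + 1)) * h₂
    apply coeff_order_eq_zero.not.2 hne
    rw [hcoeff]
    rcases order_eq_of_ode hne hode with h | h
    · rw [h, coeff_eq_zero_of_lt_order (x := ψ₁) (i := -m) (by omega),
        coeff_eq_zero_of_lt_order (x := ψ₂) (i := -m) (by omega)]
      ring
    · rw [h]; ring
  exact hc₂ (LinearIndependent.pair_iff.1 hli _ _ hdep).1

/-- The Frobenius recursion yields a solution if the compatibility conditions hold. -/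
lemma ode_frobeniusSeq {b : ℂ} {e q : ℕ → ℂ} {n : ℤ}
    (hq : ∀ k : ℕ, ((n : ℂ) + k) * (n + k - 1) + b = -q k)
    (h : ∀ k, q k = 0 → shiftedConv e (frobeniusSeq q e) k = 0) (h0 : q 0 = 0) :
    laurentDeriv (laurentDeriv (shiftedSeries n (frobeniusSeq q e))) +
      (single (-2 : ℤ) b + ofPowerSeries ℤ ℂ (PowerSeries.mk e)) *
        shiftedSeries n (frobeniusSeq q e) = 0 := by
  rw [ode_shiftedSeries_iff]
  intro k
  rw [hq]
  by_cases hk : q k = 0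
  · rw [h k hk, hk]; ring
  · have hk0 : k ≠ 0 := by rintro rfl; exact hk h0
    rw [frobeniusSeq_of_ne_zero q e hk0, smul_eq_mul]
    field_simp
    ring

/-- Lemma 2.13: for `u = −m(m+1)z⁻² + Σ_{j≥1} c_j z^j ∈ ℂ((z))`, the equation
`ψ'' + uψ = λψ` admits two linearly independent formal Laurent series solutions
for every `λ ∈ ℂ` if and only if `c₁ = c₃ = ⋯ = c_{2m−1} = 0`. -/
theorem two_independent_solutions_iff_odd_coeffs_vanish
    (m : ℕ) (c : ℕ → ℂ) (u : LaurentSeries ℂ)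
    (hu : u = HahnSeries.single (-2 : ℤ) (-((m : ℂ) * ((m : ℂ) + 1)))
        + HahnSeries.ofPowerSeries ℤ ℂ (PowerSeries.mk fun j => if j = 0 then 0 else c j)) :
    (∀ lam : ℂ, ∃ ψ₁ ψ₂ : LaurentSeries ℂ,
        laurentDeriv (laurentDeriv ψ₁) + u * ψ₁ = lam • ψ₁ ∧
        laurentDeriv (laurentDeriv ψ₂) + u * ψ₂ = lam • ψ₂ ∧
        LinearIndependent ℂ ![ψ₁, ψ₂])
      ↔ (∀ j : ℕ, Odd j → 1 ≤ j → j ≤ 2 * m - 1 → c j = 0) := by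
  have hode (lam : ℂ) (ψ : LaurentSeries ℂ) :
      laurentDeriv (laurentDeriv ψ) + u * ψ = lam • ψ ↔
        laurentDeriv (laurentDeriv ψ) + (single (-2 : ℤ) (-((m : ℂ) * (m + 1))) +
          ofPowerSeries ℤ ℂ (PowerSeries.mk fun j => if j = 0 then -lam else c j)) * ψ = 0 := by
    have hE : (PowerSeries.mk fun j => if j = 0 then -lam else c j) =
        (PowerSeries.mk fun j => if j = 0 then 0 else c j) - PowerSeries.C lam := by
      ext j
      by_cases hj : j = 0 <;> simp [PowerSeries.coeff_C, hj]
    rw [hE, map_sub, ofPowerSeries_C, ← add_sub_assoc, ← hu, sub_mul, C_mul_eq_smul,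
      ← add_sub_assoc, sub_eq_zero]
  simp only [hode]
  constructor
  · intro h j hj hj1 hjm
    have hd : ∀ k < 2 * m + 1, k ≠ 0 → (0 : ℝ) < k * (2 * m + 1 - k) := fun k hk hk0 => by
      have h1 : (k : ℝ) < 2 * m + 1 := by exact_mod_cast hk
      have h2 : (0 : ℝ) < k := by exact_mod_cast Nat.pos_of_ne_zero hk0
      exact mul_pos h2 (by linarith)
    refine odd_coeffs_eq_zero (k := 2 * m + 1) hd ⟨m, rfl⟩ (fun μ => ?_) hj (by omega)
    obtain ⟨ψ₁, ψ₂, h₁, h₂, hli⟩ := h (-μ)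
    simp only [neg_neg] at h₁ h₂
    rcases exists_order_eq_neg h₁ h₂ hli with ho | ho
    · exact shiftedConv_eq_zero_of_order_eq (hli.ne_zero 0) h₁ ho
    · exact shiftedConv_eq_zero_of_order_eq (hli.ne_zero 1) h₂ ho
  · intro hc lam
    set e : ℕ → ℂ := fun j => if j = 0 then -lam else c j with he
    have he_odd : ∀ j, j + 2 ≤ 2 * m + 1 → Odd j → e j = 0 := fun j hj ho => by
      have hj0 : j ≠ 0 := by rintro rfl; simp at ho
      simp only [he, hj0, if_false]
      exact hc j ho (by omega) (by omega)
    have hzero (a : ℕ → ℂ) : shiftedConv e a 0 = 0 := by simp [shiftedConv]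
    set q₁ : ℕ → ℂ := fun k => k * (2 * m + 1 - k) with hq₁
    set q₂ : ℕ → ℂ := fun k => -(k * (2 * m + 1 + k)) with hq₂
    refine ⟨shiftedSeries (-m) (frobeniusSeq q₁ e), shiftedSeries (m + 1) (frobeniusSeq q₂ e),
      ode_frobeniusSeq (fun k => ?_) (fun k hk => ?_) (by simp [hq₁]),
      ode_frobeniusSeq (fun k => ?_) (fun k hk => ?_) (by simp [hq₂]), ?_⟩
    · simp only [hq₁]; push_cast; ring
    · rcases mul_eq_zero.1 hk with h | h
      · rw [Nat.cast_eq_zero.1 h, hzero]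
      · have hk' : 2 * m + 1 = k := by exact_mod_cast sub_eq_zero.1 h
        subst hk'
        exact shiftedConv_odd_eq_zero ⟨m, rfl⟩ he_odd
          fun i hi => frobeniusSeq_odd_eq_zero he_odd i hi.le
    · simp only [hq₂]; push_cast; ring
    · rcases mul_eq_zero.1 (neg_eq_zero.1 hk) with h | h
      · rw [Nat.cast_eq_zero.1 h, hzero]
      · exact absurd (show 2 * m + 1 + k = 0 by exact_mod_cast h) (by omega)
    · rw [LinearIndependent.pair_iff]
      intro s t hst
      have hcoeff (n : ℤ) : s * (shiftedSeries (-m) (frobeniusSeq q₁ e)).coeff n +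
          t * (shiftedSeries (m + 1) (frobeniusSeq q₂ e)).coeff n = 0 :=
        congrArg (fun φ : LaurentSeries ℂ => φ.coeff n) hst
      have hs : s = 0 := by
        have := hcoeff (-m)
        rw [shiftedSeries_coeff, shiftedSeries_coeff, if_neg (by omega), if_pos (by omega)] at this
        simpa [frobeniusSeq_zero] using this
      have ht := hcoeff (m + 1)
      rw [hs, shiftedSeries_coeff (m + 1)] at ht
      exact ⟨hs, by simpa [frobeniusSeq_zero] using ht⟩
end

section
/- Let n ≥ 2 be an integer, let b₂, …, bₙ ∈ ℂ, and let m₀, …, m_{n−1} ∈ ℂ be such that the polynomial identity ∏_{j=0}^{n−1}(s − m_j) = ∏_{l=0}^{n−1}(s − l) + Σ_{i=2}^{n} b_i ∏_{l=0}^{n−i−1}(s − l) holds for all s ∈ ℂ (for i = n the product ∏_{l=0}^{−1} is empty and equals 1). Then the following are equivalent: (a) every m_j is an integer and the m_j are pairwise distinct modulo n; (b) there exists a polynomial Q ∈ ℂ[x] with Q(0) = 1 such that for every μ ∈ ℂ with μ ≠ 0, the function ψ(z) = e^{μz} Q(1/(μz)) satisfies, for all z ∈ ℂ ∖ {0}, ψ⁽ⁿ⁾(z)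 + Σ_{i=2}^{n} b_i z^{−i} ψ⁽ⁿ⁻ⁱ⁾(z) = μⁿ ψ(z), where ψ⁽ᵏ⁾ denotes the k-th complex derivative. -/
open Polynomial Filter Topology

/-- The coefficient of `zᵏ` in the exponential series, extended by zero to negative `k`. -/
noncomputable def expCoeff (k : ℤ) : ℂ :=
  if 0 ≤ k then ((k.toNat.factorial : ℕ) : ℂ)⁻¹ else 0

lemma expCoeff_natCast (k : ℕ) : expCoeff (k : ℤ) = ((k.factorial : ℕ) : ℂ)⁻¹ := by
  simp [expCoeff]

lemma expCoeff_of_neg {k : ℤ} (hk : k < 0) : expCoeff k = 0 := by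
  simp [expCoeff, hk]

lemma mul_expCoeff (k : ℤ) : (k : ℂ) * expCoeff k = expCoeff (k - 1) := by
  rcases lt_trichotomy k 0 with hk | rfl | hk
  · rw [expCoeff_of_neg hk, expCoeff_of_neg (by omega), mul_zero]
  · rw [expCoeff_of_neg (by omega : (0 : ℤ) - 1 < 0)]
    simp
  · obtain ⟨j, rfl⟩ : ∃ j : ℕ, k = (j + 1 : ℕ) := ⟨k.toNat - 1, by omega⟩
    rw [show ((j + 1 : ℕ) : ℤ) - 1 = (j : ℕ) by push_cast; ring, expCoeff_natCast,
      expCoeff_natCast, Nat.factorial_succ]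
    have h1 : (j : ℂ) + 1 ≠ 0 := Nat.cast_add_one_ne_zero j
    have h2 : ((j.factorial : ℕ) : ℂ) ≠ 0 := by exact_mod_cast j.factorial_ne_zero
    push_cast
    field_simp

lemma prod_sub_mul_expCoeff (n : ℕ) (k : ℤ) :
    (∏ l ∈ Finset.range n, ((k : ℂ) - l)) * expCoeff k = expCoeff (k - n) := by
  induction n with
  | zero => simp
  | succ n ih =>
    rw [Finset.prod_range_succ, mul_right_comm, ih, mul_comm]
    have h := mul_expCoeff (k - n)
    push_cast at h ⊢
    rw [h, sub_sub]

/-- The coefficient of `zᵏ` in the Laurent expansion of `e^z Q(1/z)` at `0`. -/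
noncomputable def laurentCoeff (k : ℤ) : ℂ[X] →ₗ[ℂ] ℂ :=
  Polynomial.lsum fun j => expCoeff (k + j) • LinearMap.id

lemma laurentCoeff_monomial (k : ℤ) (j : ℕ) (c : ℂ) :
    laurentCoeff k (monomial j c) = expCoeff (k + j) * c := by
  simp [laurentCoeff, Polynomial.lsum_apply, Polynomial.sum_monomial_index]

lemma laurentCoeff_eq_sum (k : ℤ) (Q : ℂ[X]) :
    laurentCoeff k Q = ∑ j ∈ Finset.range (Q.natDegree + 1), expCoeff (k + j) * Q.coeff j := by
  conv_lhs => rw [Q.as_sum_range]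
  simp [laurentCoeff_monomial]

lemma laurentCoeff_X_mul (k : ℤ) (Q : ℂ[X]) :
    laurentCoeff k (X * Q) = laurentCoeff (k + 1) Q := by
  induction Q using Polynomial.induction_on' with
  | add p q hp hq => rw [mul_add, map_add, map_add, hp, hq]
  | monomial j c =>
    rw [X_mul_monomial, laurentCoeff_monomial, laurentCoeff_monomial]
    push_cast
    rw [add_right_comm, add_assoc k]

lemma laurentCoeff_X_pow_mul (i : ℕ) (k : ℤ) (Q : ℂ[X]) :
    laurentCoeff k (X ^ i * Q) = laurentCoeff (k + i) Q := by
  induction i generalizing k with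
  | zero => simp
  | succ i ih =>
    rw [pow_succ', mul_assoc, laurentCoeff_X_mul, ih]
    push_cast
    rw [add_right_comm, add_assoc k]

lemma eq_zero_of_laurentCoeff_eq_zero {Q : ℂ[X]} (h : ∀ k, laurentCoeff k Q = 0) : Q = 0 := by
  have h0 := h (-(Q.natDegree : ℤ))
  rw [laurentCoeff_eq_sum, Finset.sum_range_succ, Finset.sum_eq_zero] at h0
  · simpa [expCoeff] using h0
  · intro j hj
    rw [expCoeff_of_neg (by have := Finset.mem_range.1 hj; omega), zero_mul]

lemma laurentCoeff_of_lt {Q : ℂ[X]} {k : ℤ} (hk : k < -(Q.natDegree : ℤ)) :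
    laurentCoeff k Q = 0 := by
  rw [laurentCoeff_eq_sum]
  refine Finset.sum_eq_zero fun j hj => ?_
  rw [expCoeff_of_neg (by have := Finset.mem_range.1 hj; omega), zero_mul]

lemma tendsto_factorial_mul_expCoeff {j : ℕ} (hj : 1 ≤ j) :
    Tendsto (fun k : ℕ => ((k.factorial : ℕ) : ℂ) * expCoeff (k + j)) atTop (𝓝 0) := by
  refine squeeze_zero_norm (a := fun k : ℕ => (1 : ℝ) / ((k : ℝ) + 1)) (fun k => ?_)
    tendsto_one_div_add_atTop_nhds_zero_nat
  have hle : (k + 1) * k.factorial ≤ (k + j).factorial := by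
    rw [← Nat.factorial_succ]
    exact Nat.factorial_le (by omega)
  have hle' : ((k : ℝ) + 1) * k.factorial ≤ (k + j).factorial := by exact_mod_cast hle
  have h1 : (0 : ℝ) < (k + j).factorial := by exact_mod_cast (k + j).factorial_pos
  rw [show (k : ℤ) + j = ((k + j : ℕ) : ℤ) by push_cast; rfl, expCoeff_natCast, norm_mul, norm_inv,
    Complex.norm_natCast, Complex.norm_natCast, ← div_eq_mul_inv,
    div_le_div_iff₀ h1 (by positivity)]
  linarith

lemma eventually_laurentCoeff_ne_zero {Q : ℂ[X]} (hQ : Q.eval 0 = 1) :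
    ∀ᶠ k : ℕ in atTop, laurentCoeff k Q ≠ 0 := by
  have hlim : Tendsto (fun k : ℕ => ((k.factorial : ℕ) : ℂ) * laurentCoeff k Q) atTop (𝓝 1) := by
    have hsum : Tendsto (fun k : ℕ => (∑ j ∈ Finset.range Q.natDegree,
        ((k.factorial : ℕ) : ℂ) * expCoeff (k + (j + 1 : ℕ)) * Q.coeff (j + 1)) + 1) atTop
        (𝓝 ((∑ j ∈ Finset.range Q.natDegree, 0 * Q.coeff (j + 1)) + 1)) :=
      (tendsto_finsetSum _ fun j _ =>
        (tendsto_factorial_mul_expCoeff (by omega)).mul_const _).add_const 1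
    simp only [zero_mul, Finset.sum_const_zero, zero_add] at hsum
    refine hsum.congr fun k => ?_
    have hk : ((k.factorial : ℕ) : ℂ) ≠ 0 := by exact_mod_cast k.factorial_ne_zero
    rw [laurentCoeff_eq_sum, Finset.sum_range_succ', mul_add, Finset.mul_sum,
      coeff_zero_eq_eval_zero, hQ]
    simp only [Nat.cast_zero, add_zero, expCoeff_natCast, mul_one, mul_inv_cancel₀ hk, mul_assoc]
  filter_upwards [hlim.eventually_ne one_ne_zero] with k hk h0
  exact hk (by rw [h0, mul_zero])

/-- The operator on polynomials induced by `d/dz` acting on `e^z Q(1/z)`. -/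
noncomputable def expDeriv (Q : ℂ[X]) : ℂ[X] := Q - X ^ 2 * derivative Q

lemma laurentCoeff_expDeriv (k : ℤ) (Q : ℂ[X]) :
    laurentCoeff k (expDeriv Q) = ((k : ℂ) + 1) * laurentCoeff (k + 1) Q := by
  rw [expDeriv, map_sub, laurentCoeff_X_pow_mul]
  induction Q using Polynomial.induction_on' with
  | add p q hp hq =>
    rw [derivative_add, map_add, map_add, map_add, mul_add, ← hp, ← hq]
    ring
  | monomial j c =>
    rw [derivative_monomial, laurentCoeff_monomial, laurentCoeff_monomial, laurentCoeff_monomial]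
    rcases j with _ | j
    · have h := mul_expCoeff (k + 1)
      push_cast at h
      simp only [add_sub_cancel_right] at h
      simp [← h, mul_assoc]
    · have h := mul_expCoeff (k + 1 + (j + 1 : ℕ))
      rw [show k + 1 + ((j + 1 : ℕ) : ℤ) - 1 = k + (j + 1 : ℕ) by ring] at h
      rw [← h, show k + ((2 : ℕ) : ℤ) + ((j + 1 - 1 : ℕ) : ℤ) = k + 1 + (j + 1 : ℕ) by
        omega]
      push_cast
      ring

lemma laurentCoeff_expDeriv_iterate (p : ℕ) (k : ℤ) (Q : ℂ[X]) :
    laurentCoeff k (expDeriv^[p] Q)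
      = (∏ l ∈ Finset.range p, (((k + p : ℤ) : ℂ) - l)) * laurentCoeff (k + p) Q := by
  induction p generalizing k with
  | zero => simp
  | succ p ih =>
    rw [Function.iterate_succ_apply', laurentCoeff_expDeriv, ih, Finset.prod_range_succ,
      show k + 1 + (p : ℤ) = k + ((p + 1 : ℕ) : ℤ) by push_cast; ring]
    push_cast
    ring

lemma hasDerivAt_exp_mul_eval (Q : ℂ[X]) {μ z : ℂ} (hμ : μ ≠ 0) (hz : z ≠ 0) :
    HasDerivAt (fun w => Complex.exp (μ * w) * Q.eval (1 / (μ * w)))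
      (μ * (Complex.exp (μ * z) * (expDeriv Q).eval (1 / (μ * z)))) z := by
  have hμz : μ * z ≠ 0 := mul_ne_zero hμ hz
  have hlin : HasDerivAt (fun w : ℂ => μ * w) μ z := by
    simpa using (hasDerivAt_id z).const_mul μ
  have hinv : HasDerivAt (fun w : ℂ => 1 / (μ * w)) (-μ / (μ * z) ^ 2) z := by
    simpa only [one_div] using hlin.fun_inv hμz
  have hQ : HasDerivAt (fun w => Q.eval (1 / (μ * w)))
      ((derivative Q).eval (1 / (μ * z)) * (-μ / (μ * z) ^ 2)) z :=
    HasDerivAt.comp z (h₂ := fun x => Q.eval x) (Q.hasDerivAt (1 / (μ * z))) hinv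
  refine (hlin.cexp.fun_mul hQ).congr_deriv ?_
  simp only [expDeriv, eval_sub, eval_mul, eval_pow, eval_X]
  field_simp
  ring

lemma iteratedDeriv_exp_mul_eval (p : ℕ) (Q : ℂ[X]) {μ : ℂ} (hμ : μ ≠ 0) {z : ℂ} (hz : z ≠ 0) :
    iteratedDeriv p (fun w => Complex.exp (μ * w) * Q.eval (1 / (μ * w))) z
      = μ ^ p * (Complex.exp (μ * z) * (expDeriv^[p] Q).eval (1 / (μ * z))) := by
  induction p generalizing z with
  | zero => simp
  | succ p ih =>
    have heq : iteratedDeriv p (fun w => Complex.exp (μ * w) * Q.eval (1 / (μ * w)))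
        =ᶠ[𝓝 z] fun w => μ ^ p * (Complex.exp (μ * w) * (expDeriv^[p] Q).eval (1 / (μ * w))) := by
      filter_upwards [isOpen_ne.mem_nhds hz] with w hw using ih hw
    rw [iteratedDeriv_succ, heq.deriv_eq,
      ((hasDerivAt_exp_mul_eval _ hμ hz).const_mul (μ ^ p)).deriv, Function.iterate_succ_apply']
    ring

/-- Termwise form, on Laurent coefficients, of the equation `L₀ψ = μⁿψ` for
`ψ(z) = e^{μz} Q(1/(μz))`, where `L₀` has indices `m`. -/
def IsBakerAkhiezer {n : ℕ} (m : Fin n → ℂ) (Q : ℂ[X]) : Prop :=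
  ∀ k : ℤ, (∏ j, ((k : ℂ) - m j)) * laurentCoeff k Q = laurentCoeff (k - n) Q

/-- The polynomial form of `L₀ψ - μⁿψ` for `ψ(z) = e^{μz} Q(1/(μz))`. -/
noncomputable def residualPoly (n : ℕ) (b : ℕ → ℂ) (Q : ℂ[X]) : ℂ[X] :=
  expDeriv^[n] Q + ∑ i ∈ Finset.Icc 2 n, C (b i) * (X ^ i * expDeriv^[n - i] Q) - Q

lemma laurentCoeff_residualPoly {n : ℕ} {b : ℕ → ℂ} {m : Fin n → ℂ}
    (hind : ∀ s : ℂ, (∏ j, (s - m j))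
        = (∏ l ∈ Finset.range n, (s - (l : ℂ)))
          + ∑ i ∈ Finset.Icc 2 n, b i * ∏ l ∈ Finset.range (n - i), (s - (l : ℂ)))
    (Q : ℂ[X]) (k : ℤ) :
    laurentCoeff (k - n) (residualPoly n b Q)
      = (∏ j, ((k : ℂ) - m j)) * laurentCoeff k Q - laurentCoeff (k - n) Q := by
  rw [residualPoly, map_sub, map_add, map_sum, hind, laurentCoeff_expDeriv_iterate,
    sub_add_cancel, add_mul, Finset.sum_mul]
  congr 2
  refine Finset.sum_congr rfl fun i hi => ?_
  have hin := (Finset.mem_Icc.1 hi).2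
  rw [← smul_eq_C_mul, map_smul, laurentCoeff_X_pow_mul, laurentCoeff_expDeriv_iterate,
    show k - n + i + ((n - i : ℕ) : ℤ) = k by omega, smul_eq_mul, mul_assoc]

lemma isBakerAkhiezer_iff_residualPoly {n : ℕ} {b : ℕ → ℂ} {m : Fin n → ℂ}
    (hind : ∀ s : ℂ, (∏ j, (s - m j))
        = (∏ l ∈ Finset.range n, (s - (l : ℂ)))
          + ∑ i ∈ Finset.Icc 2 n, b i * ∏ l ∈ Finset.range (n - i), (s - (l : ℂ)))
    (Q : ℂ[X]) : IsBakerAkhiezer m Q ↔ residualPoly n b Q = 0 := by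
  refine ⟨fun h => eq_zero_of_laurentCoeff_eq_zero fun k => ?_, fun h k => ?_⟩
  · have hk := laurentCoeff_residualPoly hind Q (k + n)
    rwa [h (k + n), sub_self, add_sub_cancel_right] at hk
  · have hk := laurentCoeff_residualPoly hind Q k
    rw [h, map_zero] at hk
    exact sub_eq_zero.1 hk.symm

lemma eval_residualPoly (n : ℕ) (b : ℕ → ℂ) (Q : ℂ[X]) {μ z : ℂ} (hμ : μ ≠ 0) (hz : z ≠ 0) :
    (iteratedDeriv n (fun w => Complex.exp (μ * w) * Q.eval (1 / (μ * w))) z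
        + ∑ i ∈ Finset.Icc 2 n, b i * z ^ (-(i : ℤ)) *
            iteratedDeriv (n - i) (fun w => Complex.exp (μ * w) * Q.eval (1 / (μ * w))) z)
      - μ ^ n * (Complex.exp (μ * z) * Q.eval (1 / (μ * z)))
      = μ ^ n * Complex.exp (μ * z) * (residualPoly n b Q).eval (1 / (μ * z)) := by
  rw [iteratedDeriv_exp_mul_eval n Q hμ hz, residualPoly, eval_sub, eval_add, eval_finsetSum,
    mul_sub, mul_add, Finset.mul_sum, mul_assoc, mul_assoc]
  congr 2
  refine Finset.sum_congr rfl fun i hi => ?_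
  have hin := (Finset.mem_Icc.1 hi).2
  rw [iteratedDeriv_exp_mul_eval (n - i) Q hμ hz, eval_mul, eval_mul, eval_C, eval_pow, eval_X,
    zpow_neg, zpow_natCast, ← pow_sub_mul_pow μ hin, one_div, inv_pow, mul_pow]
  field_simp

lemma isBakerAkhiezer_iff_forall {n : ℕ} {b : ℕ → ℂ} {m : Fin n → ℂ}
    (hind : ∀ s : ℂ, (∏ j, (s - m j))
        = (∏ l ∈ Finset.range n, (s - (l : ℂ)))
          + ∑ i ∈ Finset.Icc 2 n, b i * ∏ l ∈ Finset.range (n - i), (s - (l : ℂ)))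
    (Q : ℂ[X]) :
    IsBakerAkhiezer m Q ↔ ∀ μ : ℂ, μ ≠ 0 → ∀ z : ℂ, z ≠ 0 →
      (iteratedDeriv n (fun w => Complex.exp (μ * w) * Q.eval (1 / (μ * w))) z
        + ∑ i ∈ Finset.Icc 2 n, b i * z ^ (-(i : ℤ)) *
            iteratedDeriv (n - i) (fun w => Complex.exp (μ * w) * Q.eval (1 / (μ * w))) z)
      = μ ^ n * (Complex.exp (μ * z) * Q.eval (1 / (μ * z))) := by
  rw [isBakerAkhiezer_iff_residualPoly hind]
  refine ⟨fun h μ hμ z hz => ?_, fun h => ?_⟩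
  · rw [← sub_eq_zero, eval_residualPoly n b Q hμ hz, h, eval_zero, mul_zero]
  · refine eq_zero_of_infinite_isRoot _ ((Set.finite_singleton (0 : ℂ)).infinite_compl.mono ?_)
    intro y hy
    have hy0 : y ≠ 0 := hy
    have he := eval_residualPoly n b Q one_ne_zero (inv_ne_zero hy0)
    rw [sub_eq_zero.2 (h 1 one_ne_zero y⁻¹ (inv_ne_zero hy0))] at he
    simpa using he.symm

lemma IsBakerAkhiezer.exists_index_modEq {n : ℕ} (hn : 0 < n) {m : Fin n → ℂ} {Q : ℂ[X]}
    (hQ : Q.eval 0 = 1) (h : IsBakerAkhiezer m Q) (r : ℤ) :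
    ∃ k : ℤ, k ≡ r [ZMOD n] ∧ ∃ j, m j = k := by
  obtain ⟨N, hN⟩ := eventually_atTop.1 (eventually_laurentCoeff_ne_zero hQ)
  have hn' : (0 : ℤ) < n := by exact_mod_cast hn
  obtain ⟨k, ⟨hkr, hk⟩, hmin⟩ := Int.exists_least_of_bdd
    (P := fun k => k ≡ r [ZMOD n] ∧ laurentCoeff k Q ≠ 0)
    ⟨-(Q.natDegree : ℤ), fun k hk => not_lt.1 fun hlt => hk.2 (laurentCoeff_of_lt hlt)⟩
    ⟨r % n + n * N, by simp [Int.ModEq], by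
      have h0 := Int.emod_nonneg r hn'.ne'
      have h1 : (N : ℤ) ≤ r % n + n * N := by nlinarith
      rw [show r % n + n * N = ((r % n + n * N).toNat : ℤ) by omega]
      exact hN _ (by omega)⟩
  have hprev : laurentCoeff (k - n) Q = 0 := by
    by_contra hne
    have := hmin (k - n) ⟨by simpa [Int.ModEq] using hkr, hne⟩
    omega
  have hprod := h k
  rw [hprev] at hprod
  obtain ⟨j, -, hj⟩ := Finset.prod_eq_zero_iff.1 ((mul_eq_zero.1 hprod).resolve_right hk)
  exact ⟨k, hkr, j, (sub_eq_zero.1 hj).symm⟩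

lemma IsBakerAkhiezer.exists_int_indices {n : ℕ} (hn : 0 < n) {m : Fin n → ℂ} {Q : ℂ[X]}
    (hQ : Q.eval 0 = 1) (h : IsBakerAkhiezer m Q) :
    ∃ M : Fin n → ℤ, (∀ j, m j = (M j : ℂ)) ∧
      ∀ j k : Fin n, j ≠ k → ¬ (M j ≡ M k [ZMOD (n : ℤ)]) := by
  choose K hK J hJ using fun r : Fin n => h.exists_index_modEq hn hQ (r : ℕ)
  have hinj : ∀ r s : Fin n, K r ≡ K s [ZMOD n] → r = s := fun r s hrs => by
    have hrs' := (Int.natCast_modEq_iff.1 (((hK r).symm.trans hrs).trans (hK s)))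
    exact Fin.ext (hrs'.eq_of_lt_of_lt r.2 s.2)
  have hJinj : Function.Injective J := fun r s hrs => hinj r s <| by
    have hc : (K r : ℂ) = K s := by rw [← hJ r, ← hJ s, hrs]
    rw [Int.cast_injective hc]
  let e := Equiv.ofBijective J (Finite.injective_iff_bijective.1 hJinj)
  refine ⟨fun j => K (e.symm j), fun j => ?_, fun j k hjk hmod => hjk ?_⟩
  · rw [← hJ (e.symm j)]
    exact congrArg m (e.apply_symm_apply j).symm
  · exact e.symm.injective (hinj _ _ hmod)

lemma IsBakerAkhiezer.darboux {n : ℕ} {m : Fin n → ℂ} {Q : ℂ[X]} (h : IsBakerAkhiezer m Q)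
    (i : Fin n) :
    IsBakerAkhiezer (fun j => m j - 1 + if j = i then (n : ℂ) else 0)
      (expDeriv Q - C (m i) * (X * Q)) := by
  have hcoeff (k : ℤ) : laurentCoeff k (expDeriv Q - C (m i) * (X * Q))
      = ((k : ℂ) + 1 - m i) * laurentCoeff (k + 1) Q := by
    rw [map_sub, laurentCoeff_expDeriv, ← smul_eq_C_mul, map_smul, laurentCoeff_X_mul, smul_eq_mul]
    ring
  intro k
  have hk := h (k + 1)
  rw [← Finset.mul_prod_erase _ _ (Finset.mem_univ i)] at hk
  rw [hcoeff, hcoeff, ← Finset.mul_prod_erase _ _ (Finset.mem_univ i),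
    show k - n + 1 = k + 1 - n by ring, ← hk,
    Finset.prod_congr rfl (g := fun j => ((k + 1 : ℤ) : ℂ) - m j) fun j hj => by
      simp only [if_neg (Finset.ne_of_mem_erase hj)]
      push_cast
      ring]
  simp only [if_true]
  push_cast
  ring

lemma eval_zero_darboux {Q : ℂ[X]} (hQ : Q.eval 0 = 1) (c : ℂ) :
    (expDeriv Q - C c * (X * Q)).eval 0 = 1 := by
  simp [expDeriv, hQ]

lemma exists_isBakerAkhiezer_shift {n : ℕ} (σ : Fin n → ℂ)
    (hσ : ∀ s : ℂ, ∏ j, (s - σ j) = ∏ l ∈ Finset.range n, (s - (l : ℂ))) (N : ℕ)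
    (c : Fin n → ℕ) (hc : ∑ j, c j = N) :
    ∃ Q : ℂ[X], Q.eval 0 = 1 ∧ IsBakerAkhiezer (fun j => σ j - N + n * c j) Q := by
  induction N generalizing c with
  | zero =>
    have hc0 : ∀ j, c j = 0 := by simpa using hc
    refine ⟨1, by simp, fun k => ?_⟩
    have h1 (k : ℤ) : laurentCoeff k 1 = expCoeff k := by
      rw [← monomial_zero_one, laurentCoeff_monomial]
      simp
    simp only [hc0, Nat.cast_zero, mul_zero, add_zero, sub_zero]
    rw [hσ, h1, h1, prod_sub_mul_expCoeff]
  | succ N ih =>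
    obtain ⟨i, hi⟩ : ∃ i, c i ≠ 0 := by
      by_contra! hall
      simp [hall] at hc
    have hsum : ∑ j, (c - Pi.single i 1 : Fin n → ℕ) j = N := by
      rw [← Finset.add_sum_erase _ _ (Finset.mem_univ i)] at hc ⊢
      rw [Finset.sum_congr rfl (g := fun j => c j) fun j hj => by
        simp [Finset.ne_of_mem_erase hj]]
      simp only [Pi.sub_apply, Pi.single_eq_same]
      omega
    obtain ⟨Q, hQ, hBA⟩ := ih _ hsum
    refine ⟨_, eval_zero_darboux hQ (σ i - N + n * ((c - Pi.single i 1 : Fin n → ℕ) i : ℕ)), ?_⟩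
    convert hBA.darboux i using 2 with j
    by_cases hj : j = i
    · subst hj
      have h1 : 1 ≤ c j := Nat.one_le_iff_ne_zero.2 hi
      simp only [Pi.sub_apply, Pi.single_eq_same, if_true]
      push_cast [h1]
      ring
    · simp [hj]
      ring

lemma sum_indices {n : ℕ} (hn : 2 ≤ n) {b : ℕ → ℂ} {m : Fin n → ℂ}
    (hind : ∀ s : ℂ, (∏ j, (s - m j))
        = (∏ l ∈ Finset.range n, (s - (l : ℂ)))
          + ∑ i ∈ Finset.Icc 2 n, b i * ∏ l ∈ Finset.range (n - i), (s - (l : ℂ))) :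
    ∑ j, m j = ∑ l ∈ Finset.range n, (l : ℂ) := by
  have hpoly : ∏ j, (X - C (m j)) = (∏ l ∈ Finset.range n, (X - C (l : ℂ)))
      + ∑ i ∈ Finset.Icc 2 n, C (b i) * ∏ l ∈ Finset.range (n - i), (X - C (l : ℂ)) :=
    Polynomial.funext fun s => by
      simpa [eval_prod, eval_finsetSum] using hind s
  have h := congrArg (fun p => coeff p (n - 1)) hpoly
  have h1 := prod_X_sub_C_coeff_card_pred Finset.univ m (by simp; omega)
  have h2 := prod_X_sub_C_coeff_card_pred (Finset.range n) (fun l => (l : ℂ)) (by simp; omega)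
  rw [Finset.card_univ, Fintype.card_fin] at h1
  rw [Finset.card_range] at h2
  have h3 : (∑ i ∈ Finset.Icc 2 n,
      C (b i) * ∏ l ∈ Finset.range (n - i), (X - C (l : ℂ))).coeff (n - 1) = 0 := by
    rw [finsetSum_coeff]
    refine Finset.sum_eq_zero fun i hi => ?_
    have hi' := Finset.mem_Icc.1 hi
    rw [coeff_C_mul, coeff_eq_zero_of_natDegree_lt, mul_zero]
    rw [natDegree_prod_of_monic _ _ fun l _ => monic_X_sub_C _]
    simp only [natDegree_X_sub_C, Finset.sum_const, Finset.card_range, smul_eq_mul]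
    omega
  simp only [coeff_add, h1, h2, h3, add_zero] at h
  exact neg_injective h

lemma exists_isBakerAkhiezer_of_int {n : ℕ} (hn : 0 < n) (M : Fin n → ℤ)
    (hM : ∀ j k : Fin n, j ≠ k → ¬ (M j ≡ M k [ZMOD (n : ℤ)]))
    (hsum : ∑ j, M j = ∑ l ∈ Finset.range n, (l : ℤ)) :
    ∃ Q : ℂ[X], Q.eval 0 = 1 ∧ IsBakerAkhiezer (fun j => (M j : ℂ)) Q := by
  have hn' : (0 : ℤ) < n := by exact_mod_cast hn
  have hnonneg (j : Fin n) : 0 ≤ M j % n := Int.emod_nonneg _ hn'.ne'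
  have hlt (j : Fin n) : M j % n < n := Int.emod_lt_of_pos _ hn'
  let r : Fin n → Fin n := fun j => ⟨(M j % n).toNat, by have := hnonneg j; have := hlt j; omega⟩
  have hr (j : Fin n) : (((r j : Fin n) : ℕ) : ℤ) = M j % n := Int.toNat_of_nonneg (hnonneg j)
  have hbij : Function.Bijective r := Finite.injective_iff_bijective.1 fun j k hjk => by
    by_contra hne
    exact hM j k hne (by rw [Int.ModEq, ← hr, ← hr, hjk])
  have hprod (s : ℂ) : ∏ j, (s - ((r j : ℕ) : ℂ)) = ∏ l ∈ Finset.range n, (s - (l : ℂ)) := by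
    rw [hbij.prod_comp fun l : Fin n => s - ((l : ℕ) : ℂ), Finset.prod_range]
  have hrsum : ∑ j, M j % n = ∑ l ∈ Finset.range n, (l : ℤ) := by
    simp only [← hr]
    rw [hbij.sum_comp fun l : Fin n => ((l : ℕ) : ℤ), Finset.sum_range]
  have hdiv : ∑ j, M j / n = 0 := by
    have h : ∑ j, M j = ∑ j, M j % n + n * ∑ j, M j / n := by
      rw [Finset.mul_sum, ← Finset.sum_add_distrib]
      exact Finset.sum_congr rfl fun j _ => (Int.emod_add_mul_ediv _ _).symm
    rw [hsum, hrsum] at h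
    exact (mul_eq_zero.1 (by linarith : (n : ℤ) * ∑ j, M j / n = 0)).resolve_left hn'.ne'
  let K : ℕ := ∑ j, (M j / n).natAbs
  have hK (j : Fin n) : 0 ≤ M j / n + K := by
    have : (M j / n).natAbs ≤ K :=
      Finset.single_le_sum (f := fun j => (M j / n).natAbs) (fun _ _ => Nat.zero_le _)
        (Finset.mem_univ j)
    omega
  have hcz (j : Fin n) : ((M j / n + K).toNat : ℤ) = M j / n + K := Int.toNat_of_nonneg (hK j)
  obtain ⟨Q, hQ, hBA⟩ := exists_isBakerAkhiezer_shift (fun j => ((r j : ℕ) : ℂ)) hprod (n * K)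
    (fun j => (M j / n + K).toNat) (by
      zify
      simp [hcz, Finset.sum_add_distrib, hdiv])
  refine ⟨Q, hQ, ?_⟩
  convert hBA using 2 with j
  have hj : M j = ((r j : ℕ) : ℤ) - ((n * K : ℕ) : ℤ) + n * ((M j / n + K).toNat : ℤ) := by
    rw [hcz, hr]
    push_cast
    linarith [Int.emod_add_mul_ediv (M j) n]
  exact_mod_cast congrArg (Int.cast : ℤ → ℂ) hj


/-- The homogeneous rational operator `L₀ = ∂ⁿ + b₂ z⁻² ∂^{n−2} + ⋯ + bₙ z⁻ⁿ` with
indices `m₀, …, m_{n−1}` is algebraically integrable (admits a Baker–Akhiezer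
solution `ψ(z) = e^{μz} Q(1/(μz))` of `L₀ψ = μⁿψ` for all `μ ≠ 0`) if and only if
the indices are integers which are pairwise distinct modulo `n`. -/
theorem homogeneous_rational_operator_integrable_iff
    (n : ℕ) (hn : 2 ≤ n) (b : ℕ → ℂ) (m : Fin n → ℂ)
    (hind : ∀ s : ℂ, (∏ j, (s - m j))
        = (∏ l ∈ Finset.range n, (s - (l : ℂ)))
          + ∑ i ∈ Finset.Icc 2 n, b i * ∏ l ∈ Finset.range (n - i), (s - (l : ℂ))) :
    ((∃ M : Fin n → ℤ, (∀ j, m j = (M j : ℂ)) ∧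
        ∀ j k : Fin n, j ≠ k → ¬ (M j ≡ M k [ZMOD (n : ℤ)]))
      ↔ (∃ Q : Polynomial ℂ, Q.eval 0 = 1 ∧
          ∀ μ : ℂ, μ ≠ 0 →
            ∀ z : ℂ, z ≠ 0 →
              (iteratedDeriv n (fun w => Complex.exp (μ * w) * Q.eval (1 / (μ * w))) z
                + ∑ i ∈ Finset.Icc 2 n, b i * z ^ (-(i : ℤ)) *
                    iteratedDeriv (n - i)
                      (fun w => Complex.exp (μ * w) * Q.eval (1 / (μ * w))) z)
              = μ ^ n * (Complex.exp (μ * z) * Q.eval (1 / (μ * z))))) := by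
  simp only [← isBakerAkhiezer_iff_forall hind]
  refine ⟨fun ⟨M, hmM, hM⟩ => ?_, fun ⟨Q, hQ, hBA⟩ => hBA.exists_int_indices (by omega) hQ⟩
  have hsum := sum_indices hn hind
  obtain rfl : m = fun j => (M j : ℂ) := funext hmM
  exact exists_isBakerAkhiezer_of_int (by omega) M hM (Int.cast_injective (α := ℂ) (by
    push_cast
    exact hsum))
end

section
/- Let q and r be integers with q ≥ r ≥ 4 and r ≡ 1 (mod 3), and set s = (r−1)/3. Let e ∈ ℂ and let c' : ℕ → ℂ satisfy (r−1)(q+1)·c'(0) = e and, for every integer k with 1 ≤ k ≤ s, (3k+1)(r−3k−1)(q+3k+1)·c'(k) − 3k(r−3k)(q+3k)·c'(k−1) = e. Then e = 0, and c'(k) = 0 for all 0 ≤ k ≤ s−1. -/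
/-- One step of a two-term recurrence `a x - b y = e` preserves being a positive real multiple
of `e`, provided `a` is positive and `b` is nonnegative. -/
theorem exists_pos_mul_of_mul_sub_mul_eq {a b d : ℝ} {x y e : ℂ} (ha : 0 < a) (hb : 0 ≤ b)
    (hd : 0 ≤ d) (hy : y = d * e) (h : (a : ℂ) * x - b * y = e) :
    ∃ d' : ℝ, 0 < d' ∧ x = d' * e := by
  refine ⟨(1 + b * d) / a, by positivity, ?_⟩
  have ha' : (a : ℂ) ≠ 0 := Complex.ofReal_ne_zero.mpr ha.ne'
  subst hy
  push_cast
  field_simp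
  linear_combination h


/-- The recurrence argument from the proof of Proposition 3.7(i): if
`(r−1)(q+1)·c'(0) = e` and
`(3k+1)(r−3k−1)(q+3k+1)·c'(k) − 3k(r−3k)(q+3k)·c'(k−1) = e` for `1 ≤ k ≤ s = (r−1)/3`,
`q ≥ r ≥ 4`, `r ≡ 1 (mod 3)`, then `e = 0` and `c'(k) = 0` for `0 ≤ k ≤ s − 1`. -/
theorem recurrence_forces_e_zero (q r : ℤ) (hr : 4 ≤ r) (hqr : r ≤ q)
    (hmod : r % 3 = 1) (s : ℤ) (hs : s = (r - 1) / 3)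
    (e : ℂ) (c' : ℕ → ℂ)
    (h0 : ((r : ℂ) - 1) * ((q : ℂ) + 1) * c' 0 = e)
    (hrec : ∀ k : ℕ, 1 ≤ k → (k : ℤ) ≤ s →
      (3 * (k : ℂ) + 1) * ((r : ℂ) - 3 * (k : ℂ) - 1) * ((q : ℂ) + 3 * (k : ℂ) + 1) * c' k
        - 3 * (k : ℂ) * ((r : ℂ) - 3 * (k : ℂ)) * ((q : ℂ) + 3 * (k : ℂ)) * c' (k - 1) = e) :
    e = 0 ∧ ∀ k : ℕ, (k : ℤ) ≤ s - 1 → c' k = 0 := by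
  obtain ⟨n, rfl⟩ : ∃ n : ℕ, r = 3 * n + 4 := ⟨((r - 4) / 3).toNat, by omega⟩
  have hsn : s = n + 1 := by omega
  subst hsn
  have hq : (3 * n + 4 : ℝ) ≤ q := by exact_mod_cast hqr
  have hpos : ∀ k : ℕ, k ≤ n → ∃ d : ℝ, 0 < d ∧ c' k = d * e := by
    intro k
    induction k with
    | zero =>
      intro _
      have ha : (0 : ℝ) < (3 * n + 3) * (q + 1) := mul_pos (by positivity) (by linarith)
      refine exists_pos_mul_of_mul_sub_mul_eq (y := 0) (b := 0) (d := 0) ha le_rfl le_rfl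
        (by simp) ?_
      rw [← h0]
      push_cast
      ring
    | succ k ih =>
      intro hk
      obtain ⟨d, hd, hc⟩ := ih (by omega)
      have hkn : (k : ℝ) + 1 ≤ n := by exact_mod_cast hk
      have hk0 : (0 : ℝ) ≤ k := k.cast_nonneg
      have ha : (0 : ℝ) < (3 * k + 4) * (3 * n - 3 * k) * (q + 3 * k + 4) :=
        mul_pos (mul_pos (by linarith) (by linarith)) (by linarith)
      have hb : (0 : ℝ) ≤ (3 * k + 3) * (3 * n + 1 - 3 * k) * (q + 3 * k + 3) :=
        mul_nonneg (mul_nonneg (by linarith) (by linarith)) (by linarith)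
      refine exists_pos_mul_of_mul_sub_mul_eq ha hb hd.le hc ?_
      rw [← hrec (k + 1) (by omega) (by push_cast; omega), Nat.add_sub_cancel]
      push_cast
      ring
  have he : e = 0 := by
    obtain ⟨d, hd, hc⟩ := hpos n le_rfl
    have hlast := hrec (n + 1) (by omega) (by push_cast; omega)
    rw [Nat.add_sub_cancel, hc] at hlast
    have hn0 : (0 : ℝ) ≤ n := n.cast_nonneg
    have hB : (0 : ℝ) < 1 + (3 * n + 3) * (q + 3 * n + 3) * d := by
      have : (0 : ℝ) < (3 * n + 3) * (q + 3 * n + 3) := mul_pos (by linarith) (by linarith)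
      positivity
    refine (mul_eq_zero.mp ?_).resolve_left (Complex.ofReal_ne_zero.mpr hB.ne')
    push_cast at hlast ⊢
    linear_combination -hlast
  refine ⟨he, fun k hk => ?_⟩
  obtain ⟨d, -, hc⟩ := hpos k (by omega)
  rw [hc, he, mul_zero]
end

section
/- Let N ≥ 1, let m₁, …, m_N be positive integers, and let z₁, …, z_N be pairwise distinct complex numbers such that for every i ∈ {1, …, N} and every integer s with 1 ≤ s ≤ m_i, one has Σ_{j≠i} m_j(m_j+1)/(z_i − z_j)^{2s+1} = 0. Then there exists a nonnegative integer m such that Σ_{i=1}^{N} m_i(m_i+1) = m(m+1). -/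
namespace CalogeroMoserLocus

open Polynomial Finset

section Local

variable {ι : Type*} (z : ι → ℂ) (m : ι → ℕ)

/-- The monic polynomial with simple roots `z j`, `j ∈ s`. -/
noncomputable def nodePoly (s : Finset ι) : ℂ[X] := ∏ j ∈ s, (X - C (z j))

/-- The gauge factor `∏ (X - z j) ^ m j`. -/
noncomputable def gauge (s : Finset ι) : ℂ[X] := ∏ j ∈ s, (X - C (z j)) ^ m j

variable {z} in
lemma isCoprime_prod_pow {s : Finset ι} {i : ι} (hi : i ∉ s) (hz : Function.Injective z)
    (a : ℕ) (b : ι → ℕ) :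
    IsCoprime ((X - C (z i)) ^ a) (∏ j ∈ s, (X - C (z j)) ^ b j) :=
  IsCoprime.prod_right fun j hj => IsCoprime.pow
    (isCoprime_X_sub_C_of_isUnit_sub (sub_ne_zero.2 fun e : z i = z j => hi (hz e ▸ hj)).isUnit)

variable {z} in
lemma nodePoly_monic (s : Finset ι) : (nodePoly z s).Monic :=
  monic_prod_of_monic _ _ fun j _ => monic_X_sub_C (z j)

variable {z} in
lemma natDegree_nodePoly (s : Finset ι) : (nodePoly z s).natDegree = #s := by
  rw [nodePoly, natDegree_prod_of_monic _ _ fun j _ => monic_X_sub_C (z j)]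
  simp

variable [DecidableEq ι]

/-- The numerator of `∑ m j / (X - z j)` over the denominator `nodePoly z s`. -/
noncomputable def simplePart (s : Finset ι) : ℂ[X] :=
  ∑ j ∈ s, C (m j : ℂ) * nodePoly z (s.erase j)

/-- The numerator of `∑ c j / (X - z j) ^ 2` over the denominator `nodePoly z s ^ 2`. -/
noncomputable def doublePart (c : ι → ℂ) (s : Finset ι) : ℂ[X] :=
  ∑ j ∈ s, C (c j) * nodePoly z (s.erase j) ^ 2

/-- The numerator of `∑ m j * m k / ((X - z j) * (X - z k))`, over ordered pairs of distinct
indices, over the denominator `nodePoly z s`. -/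
noncomputable def crossPart (s : Finset ι) : ℂ[X] :=
  ∑ j ∈ s, C (m j : ℂ) * simplePart z m (s.erase j)

/-- The Schrödinger operator `∂² - ∑ m j * (m j + 1) / (X - z j) ^ 2`, conjugated by `gauge` and
cleared of denominators by `nodePoly`. -/
noncomputable def gaugedOp (s : Finset ι) : ℂ[X] →ₗ[ℂ] ℂ[X] :=
  LinearMap.mulLeft ℂ (nodePoly z s) ∘ₗ derivative ∘ₗ derivative
    - LinearMap.mulLeft ℂ (2 * simplePart z m s) ∘ₗ derivative
    + LinearMap.mulLeft ℂ (crossPart z m s)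

lemma gaugedOp_apply (s : Finset ι) (p : ℂ[X]) :
    gaugedOp z m s p = nodePoly z s * derivative (derivative p)
      - 2 * simplePart z m s * derivative p + crossPart z m s * p := by
  simp [gaugedOp, mul_assoc]

variable {z m} {s : Finset ι} {i : ι}

lemma nodePoly_insert (hi : i ∉ s) :
    nodePoly z (insert i s) = (X - C (z i)) * nodePoly z s := prod_insert hi

lemma gauge_insert (hi : i ∉ s) :
    gauge z m (insert i s) = (X - C (z i)) ^ m i * gauge z m s := prod_insert hi

lemma nodePoly_insert_erase (hi : i ∉ s) {j : ι} (hj : j ∈ s) :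
    nodePoly z ((insert i s).erase j) = (X - C (z i)) * nodePoly z (s.erase j) := by
  have hij : i ≠ j := fun h => hi (h ▸ hj)
  rw [erase_insert_of_ne hij, nodePoly_insert (fun h => hi (mem_of_mem_erase h))]

lemma simplePart_insert (hi : i ∉ s) :
    simplePart z m (insert i s)
      = C (m i : ℂ) * nodePoly z s + (X - C (z i)) * simplePart z m s := by
  rw [simplePart, sum_insert hi, erase_insert hi, simplePart, mul_sum]
  congr 1
  refine sum_congr rfl fun j hj => ?_
  rw [nodePoly_insert_erase hi hj]
  ring

lemma doublePart_insert (c : ι → ℂ) (hi : i ∉ s) :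
    doublePart z c (insert i s)
      = C (c i) * nodePoly z s ^ 2 + (X - C (z i)) ^ 2 * doublePart z c s := by
  rw [doublePart, sum_insert hi, erase_insert hi, doublePart, mul_sum]
  congr 1
  refine sum_congr rfl fun j hj => ?_
  rw [nodePoly_insert_erase hi hj]
  ring

lemma crossPart_insert (hi : i ∉ s) :
    crossPart z m (insert i s)
      = 2 * C (m i : ℂ) * simplePart z m s + (X - C (z i)) * crossPart z m s := by
  have hrow : ∀ j ∈ s, C (m j : ℂ) * simplePart z m ((insert i s).erase j)
      = C (m i : ℂ) * (C (m j : ℂ) * nodePoly z (s.erase j))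
        + (X - C (z i)) * (C (m j : ℂ) * simplePart z m (s.erase j)) := by
    intro j hj
    have hij : i ≠ j := fun h => hi (h ▸ hj)
    rw [erase_insert_of_ne hij, simplePart_insert fun h => hi (mem_of_mem_erase h)]
    ring
  rw [crossPart, sum_insert hi, erase_insert hi, sum_congr rfl hrow, sum_add_distrib,
    ← mul_sum, ← mul_sum, ← simplePart, ← crossPart]
  ring

lemma nodePoly_mul_derivative_gauge (s : Finset ι) :
    nodePoly z s * derivative (gauge z m s) = simplePart z m s * gauge z m s := by
  induction s using Finset.induction_on with
  | empty => simp [nodePoly, gauge, simplePart]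
  | insert i s hi ih =>
    rw [nodePoly_insert hi, gauge_insert hi, simplePart_insert hi]
    rcases hk : m i with _ | k
    · simp
      linear_combination (X - C (z i)) * ih
    · simp only [derivative_mul, derivative_X_sub_C_pow, Nat.add_sub_cancel]
      simp
      linear_combination (X - C (z i)) ^ (k + 2) * ih

lemma wronskian_simplePart (s : Finset ι) :
    derivative (simplePart z m s) * nodePoly z s - simplePart z m s * derivative (nodePoly z s)
      = - doublePart z (fun j => (m j : ℂ)) s := by
  induction s using Finset.induction_on with
  | empty => simp [nodePoly, doublePart, simplePart]
  | insert i s hi ih =>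
    rw [nodePoly_insert hi, simplePart_insert hi, doublePart_insert _ hi]
    simp only [derivative_mul, derivative_add, derivative_X_sub_C, derivative_C]
    linear_combination (X - C (z i)) ^ 2 * ih

lemma nodePoly_mul_crossPart (s : Finset ι) :
    nodePoly z s * crossPart z m s
      = simplePart z m s ^ 2 - doublePart z (fun j => (m j : ℂ) ^ 2) s := by
  induction s using Finset.induction_on with
  | empty => simp [crossPart, doublePart, simplePart]
  | insert i s hi ih =>
    rw [nodePoly_insert hi, simplePart_insert hi, doublePart_insert _ hi, crossPart_insert hi]
    simp only [C_pow]
    linear_combination (X - C (z i)) ^ 2 * ih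

lemma nodePoly_mul_gaugedOp_gauge_mul (hi : i ∉ s) (e : ℂ[X]) :
    nodePoly z s * gaugedOp z m (insert i s) (gauge z m s * e)
      = gauge z m s * (nodePoly z s ^ 2 * ((X - C (z i)) * derivative (derivative e)
          - 2 * C (m i : ℂ) * derivative e)
        - (X - C (z i)) * doublePart z (fun j => (m j : ℂ) * (m j + 1)) s * e) := by
  have h₁ := nodePoly_mul_derivative_gauge (z := z) (m := m) s
  have h₂ := congrArg derivative h₁
  have h₃ := wronskian_simplePart (z := z) (m := m) s
  have h₄ := nodePoly_mul_crossPart (z := z) (m := m) s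
  have h₅ : doublePart z (fun j => (m j : ℂ) * (m j + 1)) s
      = doublePart z (fun j => (m j : ℂ) ^ 2) s + doublePart z (fun j => (m j : ℂ)) s := by
    simp only [doublePart, ← sum_add_distrib, ← add_mul, ← C_add]
    refine sum_congr rfl fun j _ => ?_
    ring_nf
  rw [gaugedOp_apply, nodePoly_insert hi, simplePart_insert hi, crossPart_insert hi, h₅]
  simp only [derivative_mul, derivative_add] at h₂ ⊢
  generalize nodePoly z s = R at *
  generalize simplePart z m s = A at *
  generalize crossPart z m s = S at *
  generalize gauge z m s = Q at *
  generalize X - C (z i) = x at *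
  linear_combination x * e * R * h₂ + x * e * Q * h₃ + x * e * Q * h₄ +
    (x * e * A - x * e * derivative R - 2 * x * A * e + 2 * x * R * derivative e
      - 2 * C (m i : ℂ) * R * e) * h₁

lemma pow_dvd_gaugedOp (hi : i ∉ s) (hm : 0 < m i) {p : ℂ[X]}
    (hp : (X - C (z i)) ^ (2 * m i + 1) ∣ p) :
    (X - C (z i)) ^ (2 * m i + 1) ∣ gaugedOp z m (insert i s) p := by
  obtain ⟨w, rfl⟩ := hp
  obtain ⟨n, hn⟩ : ∃ n, m i = n + 1 := ⟨m i - 1, by omega⟩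
  rw [gaugedOp_apply, nodePoly_insert hi, simplePart_insert hi, crossPart_insert hi, hn,
    show 2 * (n + 1) + 1 = 2 * n + 1 + 1 + 1 by ring]
  simp only [derivative_mul, derivative_X_sub_C_pow, derivative_add, Nat.add_sub_cancel,
    derivative_C, zero_mul, zero_add]
  refine ⟨nodePoly z s * ((X - C (z i)) * derivative (derivative w)
      + 2 * C (2 * n + 3 : ℂ) * derivative w)
    - 2 * (C (n + 1 : ℂ) * nodePoly z s * derivative w
      + simplePart z m s * C (2 * n + 3 : ℂ) * w
      + simplePart z m s * (X - C (z i)) * derivative w)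
    + (2 * C (n + 1 : ℂ) * simplePart z m s + (X - C (z i)) * crossPart z m s) * w, ?_⟩
  have h₂ : (C 2 : ℂ[X]) = 2 := map_ofNat C 2
  have h₃ : (C 3 : ℂ[X]) = 3 := map_ofNat C 3
  simp [h₂, h₃]
  ring

lemma pow_dvd_sq_mul_truncation (a : ℂ) {d : ℂ} (hd : d ≠ 0) (n : ℕ) :
    (X - C a) ^ n ∣ 1 - (X - C a + C d) ^ 2 *
      ∑ k ∈ range n, C ((-1) ^ k * (k + 1) / d ^ (k + 2)) * (X - C a) ^ k := by
  refine ⟨C ((-1) ^ n * (n + 1) / d ^ n) + C ((-1) ^ n * n / d ^ (n + 1)) * (X - C a), ?_⟩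
  induction n with
  | zero => simp
  | succ n ih =>
    rw [sum_range_succ, mul_add, ← sub_sub, ih]
    generalize X - C a = x
    have e₁ : C ((-1) ^ n * (n + 1) / d ^ n) =
        C ((-1 : ℂ) ^ n * (n + 1) / d ^ (n + 2)) * C d ^ 2 := by
      rw [← C_pow, ← C_mul]; congr 1; field_simp; ring
    have e₂ : C ((-1) ^ n * n / d ^ (n + 1)) =
        C ((-1 : ℂ) ^ n * n / d ^ (n + 2)) * C d := by
      rw [← C_mul]; congr 1; field_simp; ring
    have e₃ : C ((-1) ^ (n + 1) * ((n + 1 : ℕ) + 1) / d ^ (n + 1)) =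
        - C ((-1 : ℂ) ^ n * (n + 2) / d ^ (n + 2)) * C d := by
      rw [← C_neg, ← C_mul]; congr 1; push_cast; field_simp; ring
    have e₄ : C ((-1) ^ (n + 1) * (n + 1 : ℕ) / d ^ (n + 1 + 1)) =
        - C ((-1 : ℂ) ^ n * (n + 1) / d ^ (n + 2)) := by
      rw [← C_neg]; congr 1; push_cast; ring
    have e₅ : C ((-1 : ℂ) ^ n * n / d ^ (n + 2)) =
        2 * C ((-1 : ℂ) ^ n * (n + 1) / d ^ (n + 2)) - C ((-1 : ℂ) ^ n * (n + 2) / d ^ (n + 2)) := by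
      rw [← C_ofNat, ← C_mul, ← C_sub]; congr 1; ring
    rw [e₁, e₂, e₃, e₄, e₅]
    ring

lemma exists_even_truncation (hi : i ∉ s) (hz : Function.Injective z) (c : ι → ℂ) (n : ℕ)
    (h : ∀ l : ℕ, 1 ≤ l → l ≤ n → ∑ j ∈ s, c j / (z i - z j) ^ (2 * l + 1) = 0) :
    ∃ V : ℂ[X], (X - C (z i)) ^ (2 * n) ∣
      doublePart z c s - nodePoly z s ^ 2 * V.comp ((X - C (z i)) ^ 2) := by
  set t : ι → ℂ[X] := fun j => ∑ k ∈ range (2 * n),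
    C ((-1) ^ k * (k + 1) / (z i - z j) ^ (k + 2)) * (X - C (z i)) ^ k with ht
  refine ⟨∑ l ∈ range n, C (∑ j ∈ s, c j * ((2 * l + 1) / (z i - z j) ^ (2 * l + 2))) * X ^ l, ?_⟩
  have hsplit : ∀ (f : ℕ → ℂ[X]) (n : ℕ), ∑ k ∈ range (2 * n), f k
      = ∑ l ∈ range n, (f (2 * l) + f (2 * l + 1)) := by
    intro f n
    induction n with
    | zero => simp
    | succ n ih =>
      rw [show 2 * (n + 1) = 2 * n + 1 + 1 by ring, sum_range_succ, sum_range_succ, ih,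
        sum_range_succ, add_assoc]
  have hV : (∑ l ∈ range n, C (∑ j ∈ s, c j * ((2 * l + 1) / (z i - z j) ^ (2 * l + 2)))
      * X ^ l).comp ((X - C (z i)) ^ 2) = ∑ j ∈ s, C (c j) * t j := by
    simp only [ht, mul_sum, ← mul_assoc, ← C_mul]
    rw [sum_comm]
    simp only [← sum_mul, ← map_sum]
    rw [hsplit, Polynomial.sum_comp]
    refine sum_congr rfl fun l hl => ?_
    have hodd : ∑ j ∈ s, c j * ((-1) ^ (2 * l + 1) * ((2 * l + 1 : ℕ) + 1)
        / (z i - z j) ^ (2 * l + 1 + 2)) = 0 := by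
      have := h (l + 1) (by omega) (by have := mem_range.1 hl; omega)
      rw [← mul_zero (-(2 * l + 2 : ℂ)), ← this, mul_sum]
      refine sum_congr rfl fun j _ => ?_
      rw [Odd.neg_one_pow ⟨l, rfl⟩, show 2 * l + 1 + 2 = 2 * (l + 1) + 1 by ring]
      push_cast
      ring
    rw [hodd, C_0, zero_mul, add_zero, mul_comp, C_comp, X_pow_comp, ← pow_mul]
    simp
  rw [hV, doublePart, mul_sum, ← sum_sub_distrib]
  refine dvd_sum fun j hj => ?_
  have hd : z i - z j ≠ 0 := sub_ne_zero.2 fun e => hi (hz e ▸ hj)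
  have hR : nodePoly z s = (X - C (z i) + C (z i - z j)) * nodePoly z (s.erase j) := by
    rw [nodePoly, ← mul_prod_erase s _ hj, nodePoly, C_sub]
    ring
  obtain ⟨w, hw⟩ := pow_dvd_sq_mul_truncation (z i) hd (2 * n)
  refine ⟨C (c j) * nodePoly z (s.erase j) ^ 2 * w, ?_⟩
  rw [hR]
  linear_combination C (c j) * nodePoly z (s.erase j) ^ 2 * hw

lemma exists_truncated_solution (n : ℕ) (V : ℂ[X]) :
    ∃ E : ℂ[X], E ≠ 0 ∧ E.natDegree ≤ n ∧
      X ^ n ∣ 4 * X * derivative (derivative E) + C (2 - 4 * n : ℂ) * derivative E - V * E := by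
  let L : ℂ[X] →ₗ[ℂ] ℂ[X] := LinearMap.mulLeft ℂ (4 * X) ∘ₗ derivative ∘ₗ derivative
    + LinearMap.mulLeft ℂ (C (2 - 4 * n : ℂ)) ∘ₗ derivative - LinearMap.mulLeft ℂ V
  let F : degreeLT ℂ (n + 1) →ₗ[ℂ] (Fin n → ℂ) :=
    LinearMap.pi fun k => lcoeff ℂ k ∘ₗ L ∘ₗ (degreeLT ℂ (n + 1)).subtype
  have hF : LinearMap.ker F ≠ ⊥ := by
    apply LinearMap.ker_ne_bot_of_finrank_lt
    rw [(degreeLTEquiv ℂ (n + 1)).finrank_eq]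
    simp
  obtain ⟨⟨E, hE⟩, hker, hne⟩ := Submodule.exists_mem_ne_zero_of_ne_bot hF
  have hE0 : E ≠ 0 := fun h => hne (by simpa using h)
  refine ⟨E, hE0, ?_, ?_⟩
  · have := (natDegree_lt_iff_degree_lt hE0).2 (mem_degreeLT.1 hE)
    omega
  · rw [X_pow_dvd_iff]
    intro k hk
    simpa [F, L, mul_assoc] using congrFun (LinearMap.mem_ker.1 hker) ⟨k, hk⟩

lemma exists_local_solution (hi : i ∉ s) (hz : Function.Injective z)
    (h : ∀ l : ℕ, 1 ≤ l → l ≤ m i →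
      ∑ j ∈ s, ((m j : ℂ) * (m j + 1)) / (z i - z j) ^ (2 * l + 1) = 0) :
    ∃ p : ℂ[X], ¬ (X - C (z i)) ^ (2 * m i + 1) ∣ p ∧
      (X - C (z i)) ^ (2 * m i + 1) ∣ gaugedOp z m (insert i s) p := by
  obtain ⟨V, u, hu⟩ := exists_even_truncation hi hz (fun j => (m j : ℂ) * (m j + 1)) (m i) h
  obtain ⟨E, hE0, hEn, w, hw⟩ := exists_truncated_solution (m i) V
  have hR : IsCoprime ((X - C (z i)) ^ (2 * m i + 1)) (nodePoly z s) := by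
    simpa [nodePoly] using isCoprime_prod_pow hi hz (2 * m i + 1) (fun _ => 1)
  have hdeg : (E.comp ((X - C (z i)) ^ 2)).natDegree = E.natDegree * 2 := by
    rw [natDegree_comp, natDegree_pow, natDegree_X_sub_C]
  have hcomp : E.comp ((X - C (z i)) ^ 2) ≠ 0 := by
    intro h0
    rcases comp_eq_zero_iff.1 h0 with h1 | ⟨-, h1⟩
    · exact hE0 h1
    · have := congrArg natDegree h1
      simp [natDegree_pow] at this
  refine ⟨gauge z m s * E.comp ((X - C (z i)) ^ 2), fun hdvd => ?_, ?_⟩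
  · have h1 := (isCoprime_prod_pow hi hz (2 * m i + 1) m).dvd_of_dvd_mul_left hdvd
    have h2 := natDegree_le_of_dvd h1 hcomp
    rw [hdeg, natDegree_pow, natDegree_X_sub_C] at h2
    omega
  · refine hR.dvd_of_dvd_mul_left ?_
    rw [nodePoly_mul_gaugedOp_gauge_mul hi]
    have hw' := congrArg (fun q : ℂ[X] => q.comp ((X - C (z i)) ^ 2)) hw
    simp only [sub_comp, add_comp, mul_comp, X_comp, X_pow_comp, C_comp, ofNat_comp] at hw'
    simp only [derivative_comp, derivative_mul, derivative_X_sub_C_pow]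
    refine ⟨gauge z m s * (nodePoly z s ^ 2 * w.comp ((X - C (z i)) ^ 2)
      - u * E.comp ((X - C (z i)) ^ 2)), ?_⟩
    have h₂ : (C 2 : ℂ[X]) = 2 := map_ofNat C 2
    have h₄ : (C 4 : ℂ[X]) = 4 := map_ofNat C 4
    simp [h₂, h₄] at hw' ⊢
    generalize E.comp ((X - C (z i)) ^ 2) = e at *
    generalize (derivative E).comp ((X - C (z i)) ^ 2) = e₁ at *
    generalize (derivative (derivative E)).comp ((X - C (z i)) ^ 2) = e₂ at *
    generalize V.comp ((X - C (z i)) ^ 2) = v at *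
    generalize w.comp ((X - C (z i)) ^ 2) = w at *
    generalize X - C (z i) = x at *
    linear_combination gauge z m s * nodePoly z s ^ 2 * x * hw' - gauge z m s * x * e * hu

lemma X_mul_simplePart_leading (s : Finset ι) :
    (X * simplePart z m s).natDegree ≤ #s ∧
      (X * simplePart z m s).coeff #s = ∑ j ∈ s, (m j : ℂ) := by
  have hdeg : ∀ j ∈ s, (X * nodePoly z (s.erase j)).natDegree = #s := by
    intro j hj
    rw [natDegree_X_mul (nodePoly_monic _).ne_zero, natDegree_nodePoly, card_erase_add_one hj]
  have hsum : X * simplePart z m s = ∑ j ∈ s, C (m j : ℂ) * (X * nodePoly z (s.erase j)) := by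
    rw [simplePart, mul_sum]
    exact sum_congr rfl fun j _ => by ring
  rw [hsum]
  constructor
  · exact natDegree_sum_le_of_forall_le _ _ fun j hj =>
      (natDegree_C_mul_le _ _).trans (hdeg j hj).le
  · rw [finsetSum_coeff]
    refine sum_congr rfl fun j hj => ?_
    rw [coeff_C_mul, ← hdeg j hj, (monic_X.mul (nodePoly_monic _)).coeff_natDegree, mul_one]

lemma X_sq_mul_crossPart_leading (s : Finset ι) :
    (X ^ 2 * crossPart z m s).natDegree ≤ #s ∧
      (X ^ 2 * crossPart z m s).coeff #s = (∑ j ∈ s, (m j : ℂ)) ^ 2 - ∑ j ∈ s, (m j : ℂ) ^ 2 := by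
  have hsum : X ^ 2 * crossPart z m s
      = ∑ j ∈ s, C (m j : ℂ) * (X * (X * simplePart z m (s.erase j))) := by
    rw [crossPart, mul_sum]
    exact sum_congr rfl fun j _ => by ring
  rw [hsum]
  constructor
  · refine natDegree_sum_le_of_forall_le _ _ fun j hj => (natDegree_C_mul_le _ _).trans ?_
    rw [← card_erase_add_one hj, add_comm]
    exact natDegree_mul_le_of_le natDegree_X_le (X_mul_simplePart_leading _).1
  · rw [finsetSum_coeff, sq, sum_mul, ← sum_sub_distrib]
    refine sum_congr rfl fun j hj => ?_
    rw [coeff_C_mul, ← card_erase_add_one hj, coeff_X_mul, (X_mul_simplePart_leading _).2,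
      ← add_sum_erase s _ hj]
    ring

lemma coeff_X_mul_derivative (p : ℂ[X]) (n : ℕ) :
    (X * derivative p).coeff n = n * p.coeff n := by
  cases n with
  | zero => simp
  | succ n => rw [coeff_X_mul, coeff_derivative]; push_cast; ring

lemma X_sq_mul_gaugedOp_leading (s : Finset ι) {p : ℂ[X]} {k : ℕ} (hp : p.natDegree ≤ k) :
    (X ^ 2 * gaugedOp z m s p).natDegree ≤ #s + k ∧
      (X ^ 2 * gaugedOp z m s p).coeff (#s + k)
        = ((k - ∑ j ∈ s, (m j : ℂ)) * (k - ∑ j ∈ s, (m j : ℂ) - 1)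
          - ∑ j ∈ s, (m j : ℂ) * (m j + 1)) * p.coeff k := by
  have h₁ : ∀ n, (X ^ 2 * derivative (derivative p)).coeff n = n * (n - 1) * p.coeff n := by
    intro n
    have : X ^ 2 * derivative (derivative p)
        = X * derivative (X * derivative p) - X * derivative p := by
      rw [derivative_mul, derivative_X]; ring
    rw [this, coeff_sub, coeff_X_mul_derivative, coeff_X_mul_derivative]
    ring
  have d₁ : (X ^ 2 * derivative (derivative p)).natDegree ≤ k :=
    natDegree_le_iff_coeff_eq_zero.2 fun n hn => by
      rw [h₁, coeff_eq_zero_of_natDegree_lt (hp.trans_lt hn), mul_zero]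
  have d₂ : (X * derivative p).natDegree ≤ k :=
    natDegree_le_iff_coeff_eq_zero.2 fun n hn => by
      rw [coeff_X_mul_derivative, coeff_eq_zero_of_natDegree_lt (hp.trans_lt hn), mul_zero]
  have hR := natDegree_nodePoly (z := z) s
  obtain ⟨dA, cA⟩ := X_mul_simplePart_leading (z := z) (m := m) s
  obtain ⟨dS, cS⟩ := X_sq_mul_crossPart_leading (z := z) (m := m) s
  have hT : X ^ 2 * gaugedOp z m s p = nodePoly z s * (X ^ 2 * derivative (derivative p))
      - C 2 * ((X * simplePart z m s) * (X * derivative p)) + (X ^ 2 * crossPart z m s) * p := by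
    rw [gaugedOp_apply, show (C 2 : ℂ[X]) = 2 from map_ofNat C 2]
    ring
  rw [hT]
  constructor
  · refine natDegree_add_le_of_degree_le ((natDegree_sub_le _ _).trans (max_le ?_ ?_)) ?_
    · exact natDegree_mul_le_of_le hR.le d₁
    · exact (natDegree_C_mul_le _ _).trans (natDegree_mul_le_of_le dA d₂)
    · exact natDegree_mul_le_of_le dS hp
  · have hR1 : (nodePoly z s).coeff #s = 1 := by
      rw [← hR, (nodePoly_monic s).coeff_natDegree]
    rw [coeff_add, coeff_sub, coeff_C_mul, coeff_mul_add_eq_of_natDegree_le hR.le d₁,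
      coeff_mul_add_eq_of_natDegree_le dA d₂, coeff_mul_add_eq_of_natDegree_le dS hp, hR1, cA, cS,
      h₁, coeff_X_mul_derivative]
    simp only [mul_add, sum_add_distrib, mul_one, ← sq]
    ring

end Local

section Global

variable {ι : Type*} [DecidableEq ι] [Fintype ι] {z : ι → ℂ} {m : ι → ℕ}

lemma exists_localized_solution (hz : Function.Injective z) (hm : ∀ i, 0 < m i) (i : ι)
    (h : ∀ l : ℕ, 1 ≤ l → l ≤ m i →
      ∑ j ∈ univ.erase i, ((m j : ℂ) * (m j + 1)) / (z i - z j) ^ (2 * l + 1) = 0) :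
    ∃ p : ℂ[X], p.degree < (∏ j, (X - C (z j)) ^ (2 * m j + 1)).degree ∧
      ¬ (X - C (z i)) ^ (2 * m i + 1) ∣ p ∧
      (∀ j ≠ i, (X - C (z j)) ^ (2 * m j + 1) ∣ p) ∧
      (∏ j, (X - C (z j)) ^ (2 * m j + 1)) ∣ gaugedOp z m univ p := by
  set G : ℂ[X] := ∏ j, (X - C (z j)) ^ (2 * m j + 1) with hG
  have hGm : G.Monic := monic_prod_of_monic _ _ fun j _ => (monic_X_sub_C (z j)).pow _
  have hdvdG : ∀ j, (X - C (z j)) ^ (2 * m j + 1) ∣ G := fun j => dvd_prod_of_mem _ (mem_univ j)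
  have hT : ∀ j (q : ℂ[X]), (X - C (z j)) ^ (2 * m j + 1) ∣ q →
      (X - C (z j)) ^ (2 * m j + 1) ∣ gaugedOp z m univ q := by
    intro j q hq
    have := pow_dvd_gaugedOp (z := z) (m := m) (notMem_erase j univ) (hm j) hq
    rwa [insert_erase (mem_univ j)] at this
  obtain ⟨q, hq, hTq⟩ := exists_local_solution (notMem_erase i univ) hz h
  rw [insert_erase (mem_univ i)] at hTq
  obtain ⟨a, b, hab⟩ := isCoprime_prod_pow (z := z) (notMem_erase i univ) hz (2 * m i + 1)
    (fun j => 2 * m j + 1)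
  set H : ℂ[X] := ∏ j ∈ univ.erase i, (X - C (z j)) ^ (2 * m j + 1) with hH
  set p : ℂ[X] := (b * H * q) %ₘ G with hp
  have hpG : ∀ j, (X - C (z j)) ^ (2 * m j + 1) ∣ p - b * H * q := fun j =>
    (hdvdG j).trans ⟨-(b * H * q /ₘ G), by
      linear_combination modByMonic_add_div (b * H * q) G⟩
  have hpi : (X - C (z i)) ^ (2 * m i + 1) ∣ p - q := by
    have : p - q = (p - b * H * q) - (X - C (z i)) ^ (2 * m i + 1) * (a * q) := by
      linear_combination q * hab
    rw [this]
    exact dvd_sub (hpG i) (dvd_mul_right _ _)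
  have hpj : ∀ j ≠ i, (X - C (z j)) ^ (2 * m j + 1) ∣ p := by
    intro j hj
    have hjH : (X - C (z j)) ^ (2 * m j + 1) ∣ H :=
      dvd_prod_of_mem (fun j => (X - C (z j)) ^ (2 * m j + 1)) (mem_erase.2 ⟨hj, mem_univ j⟩)
    exact (dvd_sub_left ((hjH.mul_left b).mul_right q)).1 (hpG j)
  refine ⟨p, degree_modByMonic_lt _ hGm, fun hd => hq ((dvd_sub_right hd).1 hpi), hpj, ?_⟩
  refine prod_dvd_of_coprime (fun j _ k _ hjk => IsCoprime.pow
    (isCoprime_X_sub_C_of_isUnit_sub (sub_ne_zero.2 (hz.ne hjk)).isUnit)) fun j _ => ?_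
  by_cases hj : j = i
  · subst hj
    have := hT j _ hpi
    rw [map_sub] at this
    exact (dvd_sub_left hTq).1 this
  · exact hT j p (hpj j hj)

lemma exists_gaugedOp_eq_zero [Nonempty ι] (hz : Function.Injective z) (hm : ∀ i, 0 < m i)
    (h : ∀ i, ∀ l : ℕ, 1 ≤ l → l ≤ m i →
      ∑ j ∈ univ.erase i, ((m j : ℂ) * (m j + 1)) / (z i - z j) ^ (2 * l + 1) = 0) :
    ∃ p : ℂ[X], p ≠ 0 ∧ gaugedOp z m univ p = 0 := by
  choose p hpdeg hpi hpj hpT using fun i => exists_localized_solution hz hm i (h i)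
  choose q hq using hpT
  set G : ℂ[X] := ∏ j, (X - C (z j)) ^ (2 * m j + 1) with hG
  have hGm : G.Monic := monic_prod_of_monic _ _ fun j _ => (monic_X_sub_C (z j)).pow _
  let F : (ι → ℂ) →ₗ[ℂ] (Fin (Fintype.card ι - 2) → ℂ) :=
    LinearMap.pi fun k => lcoeff ℂ k ∘ₗ Fintype.linearCombination ℂ q
  have hF : LinearMap.ker F ≠ ⊥ := by
    apply LinearMap.ker_ne_bot_of_finrank_lt
    have := Fintype.card_pos (α := ι)
    simp
    omega
  obtain ⟨c, hker, hne⟩ := Submodule.exists_mem_ne_zero_of_ne_bot hF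
  have hqdeg : ∀ i n, Fintype.card ι - 2 ≤ n → (q i).coeff n = 0 := by
    intro i n hn
    by_contra hne'
    have hq0 : q i ≠ 0 := fun h0 => hne' (by simp [h0])
    have h1 := (X_sq_mul_gaugedOp_leading (z := z) (m := m) univ (le_refl (p i).natDegree)).1
    have hp0 : p i ≠ 0 := fun h0 => hpi i (by simp [h0])
    have h2 := natDegree_lt_natDegree hp0 (hpdeg i)
    rw [hq, natDegree_mul (pow_ne_zero 2 X_ne_zero) (mul_ne_zero hGm.ne_zero hq0),
      natDegree_mul hGm.ne_zero hq0, natDegree_X_pow, card_univ] at h1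
    have h3 := le_natDegree_of_ne_zero hne'
    omega
  have hq0 : ∑ i, c i • q i = 0 := by
    ext n
    by_cases hn : Fintype.card ι - 2 ≤ n
    · simp [hqdeg _ n hn]
    · simpa [F, Fintype.linearCombination_apply] using
        congrFun (LinearMap.mem_ker.1 hker) ⟨n, not_le.1 hn⟩
  refine ⟨∑ i, c i • p i, fun h0 => hne (funext fun i => ?_), ?_⟩
  · by_contra hci
    rw [← add_sum_erase _ _ (mem_univ i)] at h0
    have h1 : (X - C (z i)) ^ (2 * m i + 1) ∣ ∑ j ∈ univ.erase i, c j • p j :=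
      dvd_sum fun j hj => dvd_smul_of_dvd (c j) (hpj j i (ne_of_mem_erase hj).symm)
    have h2 : (X - C (z i)) ^ (2 * m i + 1) ∣ c i • p i :=
      (dvd_add_left h1).1 (h0 ▸ dvd_zero _)
    rw [smul_eq_C_mul] at h2
    exact hpi i ((isUnit_C.2 (IsUnit.mk0 _ hci)).dvd_mul_left.1 h2)
  · simp only [map_sum, map_smul, hq, ← mul_smul_comm, ← mul_sum, hq0, mul_zero]

end Global

end CalogeroMoserLocus

/-- If positive integers `m₁, …, m_N` and pairwise distinct complex numbers
`z₁, …, z_N` satisfy `Σ_{j≠i} m_j(m_j+1)/(z_i − z_j)^{2s+1} = 0` for all `i` and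
`1 ≤ s ≤ m_i`, then `Σᵢ m_i(m_i+1) = m(m+1)` for some nonnegative integer `m`. -/
theorem sum_m_m_add_one (N : ℕ) (hN : 1 ≤ N) (m : Fin N → ℕ)
    (hm : ∀ i, 0 < m i) (z : Fin N → ℂ) (hz : Function.Injective z)
    (h : ∀ i : Fin N, ∀ s : ℕ, 1 ≤ s → s ≤ m i →
      ∑ j ∈ Finset.univ.erase i,
        ((m j * (m j + 1) : ℕ) : ℂ) / (z i - z j) ^ (2 * s + 1) = 0) :
    ∃ M : ℕ, ∑ i, m i * (m i + 1) = M * (M + 1) := by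
  have : Nonempty (Fin N) := ⟨⟨0, hN⟩⟩
  obtain ⟨p, hp, hT⟩ := CalogeroMoserLocus.exists_gaugedOp_eq_zero hz hm
    fun i l h₁ h₂ => by simpa using h i l h₁ h₂
  have hlead := (CalogeroMoserLocus.X_sq_mul_gaugedOp_leading (z := z) (m := m) Finset.univ
    (le_refl p.natDegree)).2
  rw [hT, mul_zero, Polynomial.coeff_zero, eq_comm, mul_eq_zero,
    Polynomial.coeff_natDegree, or_iff_left (Polynomial.leadingCoeff_ne_zero.2 hp),
    sub_eq_zero] at hlead
  obtain ⟨a, ha⟩ : ∃ a : ℤ, a = p.natDegree - ∑ j, (m j : ℤ) := ⟨_, rfl⟩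
  have hint : ((∑ i, m i * (m i + 1) : ℕ) : ℤ) = a * (a - 1) := by
    rw [ha]
    exact_mod_cast hlead.symm
  rcases le_or_gt a 0 with h0 | h0
  · obtain ⟨b, hb⟩ := Int.eq_ofNat_of_zero_le (neg_nonneg.2 h0)
    refine ⟨b, ?_⟩
    zify at hint ⊢
    rw [hint, ← hb]
    ring
  · obtain ⟨b, hb⟩ := Int.eq_ofNat_of_zero_le (show 0 ≤ a - 1 by omega)
    refine ⟨b, ?_⟩
    zify at hint ⊢
    rw [hint, ← hb]
    ring
end
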